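/- Let k_1, k_2 ≥ 3 be integers and set n := 3^{k_1} + 3^{k_2}. For i = 1, 2 define A_i := B_{3^{k_i}}(3^{k_i}−4) ∪ {(3^{k_i}−3, 3), (3^{k_i}−3, 1, 1, 1)}°. Then A_1 ⋆ A_2 = B_n(n−7) ∪ {(n−6, μ) : μ ∈ P(6), μ ≠ (3, 2, 1)}°, where (n−6, μ) denotes the partition of n with first part n−6 followed by the parts of μ. -/

import Mathlib

open scoped Classical

namespace SylowBranching

/-- The cells of the Young diagram of `f` (rows indexed by the first coordinate,
starting from `0`; `f i` is the length of row `i`). -/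
def cellsOf (f : ℕ → ℕ) : Set (ℕ × ℕ) := {p | p.2 < f p.1}

/-- `f : ℕ → ℕ` is a partition if it is weakly decreasing with finitely many
nonzero parts.  Its parts are `f 0 ≥ f 1 ≥ ⋯`, and its largest part is `f 0`. -/
def IsPartition (f : ℕ → ℕ) : Prop :=
  Antitone f ∧ ∃ N, ∀ i, N ≤ i → f i = 0

/-- The size `|f|` of a partition: the number of cells of its Young diagram. -/
noncomputable def psize (f : ℕ → ℕ) : ℕ := (cellsOf f).ncard

/-- `P(n)`: the set of partitions of `n`. -/
def Pset (n : ℕ) : Set (ℕ → ℕ) := {f | IsPartition f ∧ psize f = n}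

/-- The conjugate (transpose) partition `f'`. -/
noncomputable def conj (f : ℕ → ℕ) : ℕ → ℕ := fun j => Set.ncard {i | j < f i}

/-- `A° = A ∪ A'`: the closure of a set of partitions under conjugation. -/
noncomputable def conjClosure (A : Set (ℕ → ℕ)) : Set (ℕ → ℕ) := A ∪ conj '' A

/-- `B_n(t)`: partitions of `n` with largest part at most `t` and at most `t` parts. -/
noncomputable def Bset (n t : ℕ) : Set (ℕ → ℕ) :=
  {f ∈ Pset n | f 0 ≤ t ∧ conj f 0 ≤ t}

/-- The cells of the skew shape `l / m`. -/
def skewCells (l m : ℕ → ℕ) : Set (ℕ × ℕ) :=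
  {p | m p.1 ≤ p.2 ∧ p.2 < l p.1}

/-- `d` is read before (or at the same time as) `c` in the reading order of a
filling: right-to-left along rows, rows from top to bottom. -/
def readBefore (d c : ℕ × ℕ) : Prop :=
  d.1 < c.1 ∨ (d.1 = c.1 ∧ c.2 ≤ d.2)

/-- A Littlewood–Richardson filling of the cell set `γ` of weight `ν`:
all entries are positive; for every `j ≥ 1` there are exactly `ν (j-1)` entries
equal to `j` (i.e. the number of `j`s is the `j`-th part of `ν`); entries weakly
increase along rows and strictly increase down columns; and every initial
segment of the reading word (right-to-left along rows, top to bottom) contains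
at least as many entries equal to `j` as entries equal to `j+1`, for all `j ≥ 1`. -/
structure IsLRFilling (γ : Set (ℕ × ℕ)) (ν : ℕ → ℕ) (T : ℕ × ℕ → ℕ) : Prop where
  pos : ∀ c ∈ γ, 1 ≤ T c
  weight : ∀ j : ℕ, 1 ≤ j → Set.ncard {c ∈ γ | T c = j} = ν (j - 1)
  row_weak : ∀ i j j', (i, j) ∈ γ → (i, j') ∈ γ → j ≤ j' → T (i, j) ≤ T (i, j')
  col_strict : ∀ i i' j, (i, j) ∈ γ → (i', j) ∈ γ → i < i' → T (i, j) < T (i', j)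
  lattice : ∀ c ∈ γ, ∀ j : ℕ, 1 ≤ j →
    Set.ncard {d ∈ γ | T d = j + 1 ∧ readBefore d c} ≤
      Set.ncard {d ∈ γ | T d = j ∧ readBefore d c}

/-- `LR(γ)`: the set of all weights of LR fillings of `γ`. -/
def LRset (γ : Set (ℕ × ℕ)) : Set (ℕ → ℕ) := {ν | ∃ T, IsLRFilling γ ν T}

/-- The Littlewood–Richardson coefficient `c^l_{m ν}`: the number of LR fillings
of the skew shape `l / m` of weight `ν` (zero unless `m ⊆ l`); fillings are
normalised to vanish off the skew shape so that they can be counted. -/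
noncomputable def LRcoeff (l m ν : ℕ → ℕ) : ℕ :=
  Set.ncard {T : ℕ × ℕ → ℕ |
    (∀ i, m i ≤ l i) ∧ (∀ c, c ∉ skewCells l m → T c = 0) ∧
      IsLRFilling (skewCells l m) ν T}

/-- The `⋆` operation on sets of partitions:
`A ⋆ B = {λ : c^λ_{μν} > 0 for some μ ∈ A, ν ∈ B}`. -/
def starOp (A B : Set (ℕ → ℕ)) : Set (ℕ → ℕ) :=
  {l | IsPartition l ∧ ∃ μ ∈ A, ∃ ν ∈ B, 0 < LRcoeff l μ ν}

/-- The partition with the given (weakly decreasing) list of parts. -/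
def ofList (L : List ℕ) : ℕ → ℕ := fun i => L.getD i 0

/-- The hook partition `(a, 1^b)`. -/
def hookP (a b : ℕ) : ℕ → ℕ := ofList (a :: List.replicate b 1)

/-- The partition `(a, μ)` obtained by prepending a first part `a` to `μ`. -/
def consPart (a : ℕ) (μ : ℕ → ℕ) : ℕ → ℕ := fun i => if i = 0 then a else μ (i - 1)

/-- `γ` coincides, up to planar translation, with the Young diagram of `ν`. -/
def TranslateOf (γ : Set (ℕ × ℕ)) (ν : ℕ → ℕ) : Prop :=
  ∃ a b : ℕ, γ = (fun p : ℕ × ℕ => (p.1 + a, p.2 + b)) '' cellsOf ν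

/-- `γ` coincides, up to planar translation, with the 180°-rotation of the
Young diagram of `ν`. -/
def RotationOf (γ : Set (ℕ × ℕ)) (ν : ℕ → ℕ) : Prop :=
  ∃ a b : ℕ, (∀ p ∈ cellsOf ν, p.1 ≤ a ∧ p.2 ≤ b) ∧
    γ = (fun p : ℕ × ℕ => (a - p.1, b - p.2)) '' cellsOf ν

/-- Iterated Littlewood–Richardson coefficients `c^l_{μ^1, …, μ^r}`:
`c^l_{μ} = δ_{l μ}`, and the coefficient for a longer list is obtained by
summing, over partitions `g` of the total size of the remaining factors, the
product of the iterated coefficient of `g` with `c^l_{g μ}`. -/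
noncomputable def iterLR : List (ℕ → ℕ) → (ℕ → ℕ) → ℕ
  | [], l => if l = (fun _ => 0 : ℕ → ℕ) then 1 else 0
  | [μ], l => if l = μ then 1 else 0
  | μ :: μs, l =>
      ∑' g : {g : ℕ → ℕ // IsPartition g ∧ psize g = (μs.map psize).sum},
        iterLR μs g.1 * LRcoeff l g.1 μ

/-- `D(q, m, B)`: partitions `λ` of `qm` with `c^λ_{μ_1, …, μ_q} > 0` for some
`μ_1, …, μ_q ∈ B` that are not all equal. -/
noncomputable def Dset (q m : ℕ) (B : Set (ℕ → ℕ)) : Set (ℕ → ℕ) :=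
  {l ∈ Pset (q * m) | ∃ μ : Fin q → (ℕ → ℕ),
    (∀ i, μ i ∈ B) ∧ (∃ i j, μ i ≠ μ j) ∧ 0 < iterLR (List.ofFn μ) l}

/-- Iterated `⋆` of a list of sets of partitions. -/
def starAll : List (Set (ℕ → ℕ)) → Set (ℕ → ℕ)
  | [] => Pset 0
  | [A] => A
  | A :: B :: rest => starOp A (starAll (B :: rest))

/-- `Ω(φ(1,0,…,0))` for the Sylow 3-subgroup of `S_{3^k}` (`k ≥ 4`):
`B_{3^k}(2a) ∖ {(2a, a−1, 1), (2a, 2, 1^{a−2}), (2a−1, a+1), (2a−1, 1^{a+1})}°`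
where `a = 3^{k−1}`. -/
noncomputable def Cset (k : ℕ) : Set (ℕ → ℕ) :=
  Bset (3 ^ k) (2 * 3 ^ (k - 1)) \
    conjClosure
      {ofList [2 * 3 ^ (k - 1), 3 ^ (k - 1) - 1, 1],
       ofList (2 * 3 ^ (k - 1) :: 2 :: List.replicate (3 ^ (k - 1) - 2) 1),
       ofList [2 * 3 ^ (k - 1) - 1, 3 ^ (k - 1) + 1],
       hookP (2 * 3 ^ (k - 1) - 1) (3 ^ (k - 1) + 1)}

/-! ### Partitions, conjugates and sizes -/

theorem conj_eq_of_lt_iff {f g : ℕ → ℕ} (h : ∀ i j, i < g j ↔ j < f i) : conj f = g := by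
  funext j
  have : {i | j < f i} = ((Finset.range (g j) : Finset ℕ) : Set ℕ) := by
    ext i; simp [h]
  rw [conj, this, Set.ncard_coe_finset, Finset.card_range]

theorem IsPartition.lt_conj_iff {f : ℕ → ℕ} (hf : IsPartition f) (i j : ℕ) :
    i < conj f j ↔ j < f i := by
  obtain ⟨ha, N, hN⟩ := hf
  have hex : ∃ i, f i ≤ j := ⟨N, by simp [hN N le_rfl]⟩
  have : {i | j < f i} = ((Finset.range (Nat.find hex) : Finset ℕ) : Set ℕ) := by
    ext i
    simp only [Set.mem_ofPred_eq, Finset.coe_range, Set.mem_Iio, Nat.lt_find_iff, not_le]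
    exact ⟨fun h m hm => h.trans_le (ha hm), fun h => h i le_rfl⟩
  have hc : conj f j = Nat.find hex := by
    rw [conj, this, Set.ncard_coe_finset, Finset.card_range]
  rw [hc]
  simp only [Nat.lt_find_iff, not_le]
  exact ⟨fun h => h i le_rfl, fun h m hm => h.trans_le (ha hm)⟩

theorem IsPartition.conj_le_iff {f : ℕ → ℕ} (hf : IsPartition f) (i j : ℕ) :
    conj f j ≤ i ↔ f i ≤ j := by
  have := hf.lt_conj_iff i j
  omega

theorem IsPartition.conj {f : ℕ → ℕ} (hf : IsPartition f) :
    IsPartition (SylowBranching.conj f) := by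
  refine ⟨fun a b hab => ?_, f 0, fun j hj => ?_⟩
  · rw [hf.conj_le_iff]
    exact ((hf.conj_le_iff _ _).1 le_rfl).trans hab
  · exact Nat.le_zero.1 ((hf.conj_le_iff _ _).2 hj)

theorem IsPartition.conj_conj {f : ℕ → ℕ} (hf : IsPartition f) :
    SylowBranching.conj (SylowBranching.conj f) = f :=
  conj_eq_of_lt_iff fun i j => (hf.lt_conj_iff j i).symm

theorem ncard_rows (I : ℕ) (l u : ℕ → ℕ) :
    Set.ncard {d : ℕ × ℕ | d.1 < I ∧ l d.1 ≤ d.2 ∧ d.2 < u d.1} =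
      ∑ i ∈ Finset.range I, (u i - l i) := by
  have : {d : ℕ × ℕ | d.1 < I ∧ l d.1 ≤ d.2 ∧ d.2 < u d.1} =
      (((Finset.range I).sigma fun i => Finset.Ico (l i) (u i)).map
        (Equiv.sigmaEquivProd ℕ ℕ).toEmbedding : Finset (ℕ × ℕ)) := by
    ext ⟨i, c⟩
    simp
  rw [this, Set.ncard_coe_finset, Finset.card_map, Finset.card_sigma]
  simp

theorem finite_rows (I : ℕ) (l u : ℕ → ℕ) :
    {d : ℕ × ℕ | d.1 < I ∧ l d.1 ≤ d.2 ∧ d.2 < u d.1}.Finite := by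
  refine ((Finset.range I).sigma fun i => Finset.Ico (l i) (u i)).finite_toSet.image
    (Equiv.sigmaEquivProd ℕ ℕ) |>.subset ?_
  rintro ⟨i, c⟩ h
  simpa using h

theorem psize_eq_sum {f : ℕ → ℕ} {N : ℕ} (hN : ∀ i, N ≤ i → f i = 0) :
    psize f = ∑ i ∈ Finset.range N, f i := by
  have : cellsOf f = {d : ℕ × ℕ | d.1 < N ∧ 0 ≤ d.2 ∧ d.2 < f d.1} := by
    ext ⟨i, c⟩
    simp only [cellsOf, Set.mem_ofPred_eq, zero_le, true_and]
    refine ⟨fun h => ⟨?_, h⟩, fun h => h.2⟩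
    by_contra hi
    simp [hN i (not_lt.1 hi)] at h
  rw [psize, this, ncard_rows N (fun _ => 0) f]
  simp

theorem psize_conj (f : ℕ → ℕ) (hf : IsPartition f) : psize (conj f) = psize f := by
  have : cellsOf (conj f) = Prod.swap '' cellsOf f := by
    ext ⟨i, c⟩
    simp [cellsOf, hf.lt_conj_iff]
  rw [psize, this, Set.ncard_image_of_injective _ Prod.swap_injective, psize]

theorem conj_mem_Pset {f : ℕ → ℕ} {n : ℕ} (hf : f ∈ Pset n) : conj f ∈ Pset n :=
  ⟨hf.1.conj, (psize_conj f hf.1).trans hf.2⟩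

theorem apply_eq_zero_of_psize_le {f : ℕ → ℕ} (hf : IsPartition f) {t : ℕ} (h : psize f ≤ t) :
    f t = 0 := by
  by_contra h0
  obtain ⟨ha, N, hN⟩ := hf
  have htN : t < N := by
    by_contra hc
    exact h0 (hN t (not_lt.1 hc))
  rw [psize_eq_sum hN] at h
  have h1 : ∑ i ∈ Finset.range (t + 1), 1 ≤ ∑ i ∈ Finset.range (t + 1), f i :=
    Finset.sum_le_sum fun i hi =>
      (Nat.one_le_iff_ne_zero.2 h0).trans (ha (Nat.lt_succ_iff.1 (Finset.mem_range.1 hi)))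
  have h2 := Finset.sum_le_sum_of_subset (f := f)
    (Finset.range_subset_range.2 (Nat.succ_le_of_lt htN))
  simp only [Finset.sum_const, Finset.card_range, smul_eq_mul, mul_one] at h1
  simp only [Nat.succ_eq_add_one] at h2
  omega

/-! ### Prepending a row or a column -/

/-- The partition obtained by prepending a first column of length `x` to `f`. -/
def addCol (x : ℕ) (f : ℕ → ℕ) : ℕ → ℕ := fun i => f i + if i < x then 1 else 0

theorem isPartition_consPart {a : ℕ} {f : ℕ → ℕ} (hf : IsPartition f) (h : f 0 ≤ a) :
    IsPartition (consPart a f) := by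
  obtain ⟨ha, N, hN⟩ := hf
  refine ⟨antitone_nat_of_succ_le fun i => ?_, N + 1, fun i hi => ?_⟩
  · rcases i with _ | i
    · simpa [consPart] using h
    · simpa [consPart] using ha (Nat.le_succ i)
  · rcases i with _ | i
    · omega
    · simpa [consPart] using hN i (by omega)

theorem psize_consPart (a : ℕ) {f : ℕ → ℕ} (hf : IsPartition f) :
    psize (consPart a f) = a + psize f := by
  obtain ⟨ha, N, hN⟩ := hf
  rw [psize_eq_sum hN, psize_eq_sum (N := N + 1) (f := consPart a f), Finset.sum_range_succ']
  · simp [consPart, add_comm]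
  · intro i hi
    rcases i with _ | i
    · omega
    · simpa [consPart] using hN i (by omega)

theorem isPartition_addCol {x : ℕ} {f : ℕ → ℕ} (hf : IsPartition f) :
    IsPartition (addCol x f) := by
  obtain ⟨ha, N, hN⟩ := hf
  refine ⟨fun i j hij => ?_, max N x, fun i hi => ?_⟩
  · have := ha hij
    simp only [addCol]
    split_ifs <;> omega
  · simp [addCol, hN i (le_of_max_le_left hi), le_of_max_le_right hi]

theorem psize_addCol (x : ℕ) {f : ℕ → ℕ} (hf : IsPartition f) :
    psize (addCol x f) = x + psize f := by
  obtain ⟨ha, N, hN⟩ := hf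
  rw [psize_eq_sum (N := N + x) (f := f) fun i hi => hN i (by omega),
    psize_eq_sum (N := N + x) (f := addCol x f)]
  · simp only [addCol, Finset.sum_add_distrib, Finset.sum_boole]
    have : (Finset.range (N + x)).filter (· < x) = Finset.range x := by
      ext i; simp; omega
    rw [this]; simp [add_comm]
  · intro i hi
    have := hN i (by omega)
    simp [addCol, this]; omega

theorem conj_consPart {a : ℕ} {f : ℕ → ℕ} (hf : IsPartition f) (h : f 0 ≤ a) :
    conj (consPart a f) = addCol a (conj f) := by
  apply conj_eq_of_lt_iff
  intro i j
  rcases i with _ | i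
  · have h1 := hf.conj_le_iff 0 j
    simp only [addCol, consPart]
    split_ifs <;> simp <;> omega
  · have h1 := hf.lt_conj_iff i j
    have h2 := hf.1 (Nat.zero_le i)
    simp only [addCol, consPart, Nat.add_eq_zero_iff, one_ne_zero, and_false, if_false,
      Nat.add_sub_cancel]
    split_ifs <;> omega

theorem exists_consPart_of_mem_Pset {f : ℕ → ℕ} {n a b : ℕ} (hf : f ∈ Pset n) (ha : f 0 = a)
    (hn : n = a + b) : ∃ g ∈ Pset b, g 0 ≤ a ∧ f = consPart a g := by
  obtain ⟨⟨hd, N, hN⟩, hs⟩ := hf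
  have hg : IsPartition fun i => f (i + 1) :=
    ⟨fun i j hij => hd (by omega), N, fun i hi => hN _ (by omega)⟩
  have he : f = consPart a fun i => f (i + 1) := by
    funext i
    rcases i with _ | i <;> simp [consPart, ha]
  refine ⟨fun i => f (i + 1), ⟨hg, ?_⟩, ha ▸ hd (Nat.zero_le 1), he⟩
  have := psize_consPart a hg
  rw [← he, hs] at this
  omega

theorem exists_addCol_of_mem_Pset {f : ℕ → ℕ} {n a b : ℕ} (hf : f ∈ Pset n) (ha : conj f 0 = a)
    (hn : n = a + b) :
    ∃ g ∈ Pset b, g 0 ≤ a ∧ conj f = consPart a g ∧ f = addCol a (conj g) := by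
  obtain ⟨g, hg, hga, he⟩ := exists_consPart_of_mem_Pset (conj_mem_Pset hf) ha hn
  exact ⟨g, hg, hga, he, by rw [← conj_consPart hg.1 hga, ← he, hf.1.conj_conj]⟩

/-! ### Littlewood–Richardson matrices -/

/-- `a i j` records the number of entries `j + 1` in row `i` of a Littlewood–Richardson
filling of `l / m` of weight `ν`. -/
structure IsLRMatrix (l m ν : ℕ → ℕ) (a : ℕ → ℕ → ℕ) : Prop where
  zero : ∀ i j, i < j → a i j = 0
  row : ∀ i, l i = m i + ∑ j ∈ Finset.range (i + 1), a i j
  strict : ∀ i j, m (i + 1) + ∑ j' ∈ Finset.range (j + 1), a (i + 1) j' ≤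
    m i + ∑ j' ∈ Finset.range j, a i j'
  lattice : ∀ i j, ∑ i' ∈ Finset.range (i + 1), a i' (j + 1) ≤ ∑ i' ∈ Finset.range i, a i' j
  weight : ∃ N₀, ∀ N, N₀ ≤ N → ∀ j, ν j = ∑ i ∈ Finset.range N, a i j

/-- `c^l_{m ν}` is positive, as witnessed by a Littlewood–Richardson matrix. -/
def LRPos (l m ν : ℕ → ℕ) : Prop := ∃ a, IsLRMatrix l m ν a

theorem LRPos.add {l m ν l' m' ν' : ℕ → ℕ} (h : LRPos l m ν) (h' : LRPos l' m' ν') :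
    LRPos (l + l') (m + m') (ν + ν') := by
  obtain ⟨a, ha⟩ := h
  obtain ⟨b, hb⟩ := h'
  refine ⟨fun i j => a i j + b i j, fun i j hij => ?_, fun i => ?_, fun i j => ?_,
    fun i j => ?_, ?_⟩
  · simp [ha.zero i j hij, hb.zero i j hij]
  · simp only [Pi.add_apply, Finset.sum_add_distrib]
    linarith [ha.row i, hb.row i]
  · simp only [Pi.add_apply, Finset.sum_add_distrib]
    linarith [ha.strict i j, hb.strict i j]
  · simp only [Finset.sum_add_distrib]
    linarith [ha.lattice i j, hb.lattice i j]
  · obtain ⟨N, hN⟩ := ha.weight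
    obtain ⟨N', hN'⟩ := hb.weight
    refine ⟨max N N', fun M hM j => ?_⟩
    simp only [Pi.add_apply, Finset.sum_add_distrib]
    rw [hN M (le_of_max_le_left hM), hN' M (le_of_max_le_right hM)]

theorem LRPos.zero : LRPos (fun _ => 0) (fun _ => 0) (fun _ => 0) :=
  ⟨fun _ _ => 0, by simp, by simp, by simp, by simp, 0, by simp⟩

theorem LRPos.single_col (x y : ℕ) :
    LRPos (addCol (x + y) fun _ => 0) (addCol x fun _ => 0) (addCol y fun _ => 0) := by
  have key : ∀ i n, ∑ j ∈ Finset.range n, (if x + j = i ∧ j < y then 1 else 0 : ℕ) =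
      if x ≤ i ∧ i < x + y ∧ i < x + n then 1 else 0 := by
    intro i n
    induction n with
    | zero => simp; omega
    | succ n ih =>
      rw [Finset.sum_range_succ, ih]
      split_ifs <;> omega
  have key' : ∀ j n, ∑ i ∈ Finset.range n, (if x + j = i ∧ j < y then 1 else 0 : ℕ) =
      if x + j < n ∧ j < y then 1 else 0 := by
    intro j n
    induction n with
    | zero => simp
    | succ n ih =>
      rw [Finset.sum_range_succ, ih]
      split_ifs <;> omega
  refine ⟨fun i j => if x + j = i ∧ j < y then 1 else 0, fun i j hij => ?_, fun i => ?_,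
    fun i j => ?_, fun i j => ?_, x + y, fun N hN j => ?_⟩
  · rw [if_neg]; omega
  · rw [key]; simp only [addCol]; split_ifs <;> omega
  · rw [key, key]; simp only [addCol]; split_ifs <;> omega
  · rw [key', key']; split_ifs <;> omega
  · rw [key']; simp only [addCol]; split_ifs <;> omega

theorem LRPos.addCol {l m ν : ℕ → ℕ} (h : LRPos l m ν) (x y : ℕ) :
    LRPos (addCol (x + y) l) (addCol x m) (addCol y ν) := by
  have := h.add (LRPos.single_col x y)
  convert this using 1 <;> funext i <;> simp [SylowBranching.addCol]

theorem LRPos.consPart {l m ν : ℕ → ℕ} (h : LRPos l m ν) {x y : ℕ} (hx : m 0 ≤ x)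
    (hy : ν 0 ≤ y) :
    LRPos (consPart (x + y) l) (consPart x m) (consPart y ν) := by
  obtain ⟨a, ha⟩ := h
  obtain ⟨N₀, hN₀⟩ := ha.weight
  have hle : ∀ i, ∑ i' ∈ Finset.range i, a i' 0 ≤ y := fun i => by
    rw [hN₀ (max N₀ i) (le_max_left _ _)] at hy
    exact (Finset.sum_le_sum_of_subset
      (Finset.range_subset_range.2 (le_max_right N₀ i))).trans hy
  have h0 : ∀ j, ∑ j' ∈ Finset.range j, a 0 j' ≤ y := fun j => by
    rcases j with _ | j
    · simp
    · rw [Finset.sum_range_succ', Finset.sum_eq_zero fun j' _ => ha.zero 0 (j' + 1) (by omega)]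
      simpa using hle 1
  let b : ℕ → ℕ → ℕ
    | 0, 0 => y
    | 0, _ + 1 => 0
    | _ + 1, 0 => 0
    | i + 1, j + 1 => a i j
  have hb0 : ∀ j, ∑ j' ∈ Finset.range (j + 1), b 0 j' = y := fun j => by
    rw [Finset.sum_range_succ']; simp [b]
  have hbs : ∀ i j, ∑ j' ∈ Finset.range (j + 1), b (i + 1) j' =
      ∑ j' ∈ Finset.range j, a i j' := fun i j => by
    rw [Finset.sum_range_succ']; simp [b]
  have hc0 : ∀ i, ∑ i' ∈ Finset.range (i + 1), b i' 0 = y := fun i => by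
    rw [Finset.sum_range_succ']; simp [b]
  have hcs : ∀ i j, ∑ i' ∈ Finset.range (i + 1), b i' (j + 1) =
      ∑ i' ∈ Finset.range i, a i' j := fun i j => by
    rw [Finset.sum_range_succ']; simp [b]
  refine ⟨b, fun i j hij => ?_, fun i => ?_, fun i j => ?_, fun i j => ?_,
    N₀ + 1, fun N hN j => ?_⟩
  · rcases i with _ | i <;> rcases j with _ | j
    · omega
    · rfl
    · rfl
    · exact ha.zero i j (by omega)
  · rcases i with _ | i
    · rw [hb0]; simp [SylowBranching.consPart]
    · rw [hbs]; simpa [SylowBranching.consPart] using ha.row i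
  · rw [hbs]
    rcases i with _ | i
    · rcases j with _ | j
      · simpa [SylowBranching.consPart] using hx
      · rw [hb0]
        have := h0 (j + 1)
        simp only [SylowBranching.consPart]
        simp; omega
    · rcases j with _ | j
      · have := ha.strict i 0
        simp [SylowBranching.consPart] at this ⊢
        omega
      · rw [hbs]; simpa [SylowBranching.consPart] using ha.strict i j
  · rw [hcs]
    rcases i with _ | i
    · simp
    · rcases j with _ | j
      · rw [hc0]; exact hle _
      · rw [hcs]; exact ha.lattice i j
  · obtain ⟨N, rfl⟩ : ∃ M, N = M + 1 := ⟨N - 1, by omega⟩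
    rcases j with _ | j
    · rw [hc0]; simp [SylowBranching.consPart]
    · rw [hcs]; simpa [SylowBranching.consPart] using hN₀ N (by omega) j

/-! ### From matrices to fillings -/

theorem skewCells_finite {l : ℕ → ℕ} (hl : IsPartition l) (m : ℕ → ℕ) :
    (skewCells l m).Finite := by
  obtain ⟨N, hN⟩ := hl.2
  refine (finite_rows N m l).subset ?_
  rintro ⟨i, c⟩ ⟨h1, h2⟩
  refine ⟨?_, h1, h2⟩
  by_contra hi
  simp [hN i (not_lt.1 hi)] at h2

theorem IsLRFilling.weight_pos {γ : Set (ℕ × ℕ)} {ν : ℕ → ℕ} {T : ℕ × ℕ → ℕ}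
    (hT : IsLRFilling γ ν T) (hγ : γ.Finite) {c : ℕ × ℕ} (hc : c ∈ γ) : 0 < ν (T c - 1) := by
  rw [← hT.weight (T c) (hT.pos c hc), Set.ncard_pos (hγ.subset fun _ h => h.1)]
  exact ⟨c, hc, rfl⟩

theorem lrCoeff_finite {l m ν : ℕ → ℕ} (hl : IsPartition l) (hν : IsPartition ν) :
    {T : ℕ × ℕ → ℕ | (∀ i, m i ≤ l i) ∧ (∀ c, c ∉ skewCells l m → T c = 0) ∧
      IsLRFilling (skewCells l m) ν T}.Finite := by
  obtain ⟨M, hM⟩ := hν.2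
  have hfin := skewCells_finite hl m
  have : Finite (skewCells l m) := hfin
  have hbd : ∀ T, IsLRFilling (skewCells l m) ν T → ∀ c ∈ skewCells l m, T c < M + 1 := by
    intro T hT c hc
    by_contra hlt
    have h1 := hT.weight_pos hfin hc
    rw [hM _ (by omega)] at h1
    exact lt_irrefl _ h1
  refine Set.Finite.of_injOn (f := fun T (c : skewCells l m) => (Fin.ofNat (M + 1) (T c)))
    (t := Set.univ) (fun _ _ => Set.mem_univ _) ?_ Set.finite_univ
  rintro T ⟨-, hT0, hT⟩ T' ⟨-, hT0', hT'⟩ h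
  funext c
  by_cases hc : c ∈ skewCells l m
  · have h1 := congrArg Fin.val (congrFun h ⟨c, hc⟩)
    simpa [Fin.ofNat, Nat.mod_eq_of_lt (hbd T hT c hc), Nat.mod_eq_of_lt (hbd T' hT' c hc)]
      using h1
  · rw [hT0 c hc, hT0' c hc]

theorem lrCoeff_pos_of_filling {l m ν : ℕ → ℕ} {T : ℕ × ℕ → ℕ} (hl : IsPartition l)
    (hν : IsPartition ν) (hml : ∀ i, m i ≤ l i) (hT : IsLRFilling (skewCells l m) ν T) :
    0 < LRcoeff l m ν := by
  have heq : ∀ c ∈ skewCells l m, (if c ∈ skewCells l m then T c else 0) = T c :=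
    fun c hc => if_pos hc
  have hset : ∀ P : ℕ × ℕ → ℕ → Prop,
      {c | c ∈ skewCells l m ∧ P c (if c ∈ skewCells l m then T c else 0)} =
        {c | c ∈ skewCells l m ∧ P c (T c)} := by
    intro P
    ext c
    simp only [Set.mem_ofPred_eq]
    exact and_congr_right fun hc => by rw [heq c hc]
  refine (Set.ncard_pos (lrCoeff_finite hl hν)).2
    ⟨fun c => if c ∈ skewCells l m then T c else 0, hml, fun c hc => if_neg hc, ?_⟩
  refine ⟨fun c hc => ?_, fun j hj => ?_, fun i j j' h h' hjj => ?_, fun i i' j h h' hii => ?_,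
    fun c hc j hj => ?_⟩
  · simpa only [heq c hc] using hT.pos c hc
  · rw [hset fun _ t => t = j]; exact hT.weight j hj
  · simpa only [heq _ h, heq _ h'] using hT.row_weak i j j' h h' hjj
  · simpa only [heq _ h, heq _ h'] using hT.col_strict i i' j h h' hii
  · rw [hset fun d t => t = j + 1 ∧ readBefore d c, hset fun d t => t = j ∧ readBefore d c]
    exact hT.lattice c hc j hj

theorem LRPos.lrCoeff_pos {l m ν : ℕ → ℕ} (h : LRPos l m ν) (hl : IsPartition l)
    (hν : IsPartition ν) : 0 < LRcoeff l m ν := by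
  obtain ⟨a, ha⟩ := h
  -- `p i j` is the column at which the entries `j + 1` of row `i` start
  set p : ℕ → ℕ → ℕ := fun i j => m i + ∑ j' ∈ Finset.range j, a i j' with hp
  have hp0 : ∀ i, p i 0 = m i := fun i => by simp [hp]
  have hpa : ∀ i j, p i (j + 1) = p i j + a i j := fun i j => by
    simp [hp, Finset.sum_range_succ, add_assoc]
  have hpm : ∀ i, Monotone (p i) := fun i => monotone_nat_of_le_succ fun j => by
    rw [hpa]; omega
  have hpl : ∀ i, p i (i + 1) = l i := fun i => (ha.row i).symm
  have hpl' : ∀ i j, p i j ≤ l i := fun i j => by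
    rcases le_total j (i + 1) with h | h
    · exact (hpm i h).trans (hpl i).le
    · rw [← hpl i]
      induction j, h using Nat.le_induction with
      | base => exact le_rfl
      | succ j hj ih => rw [hpa, ha.zero i j (by omega)]; exact ih
  have hps : ∀ i i' j, i < i' → p i' (j + 1) ≤ p i j := by
    intro i i' j hii
    induction i', hii using Nat.le_induction with
    | base => exact ha.strict i j
    | succ i' _ ih => exact (ha.strict i' j).trans ((hpm i' (Nat.le_succ j)).trans ih)
  set T : ℕ × ℕ → ℕ := fun c => ((Finset.range (c.1 + 1)).filter fun j => p c.1 j ≤ c.2).card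
    with hTdef
  have hTle : ∀ i c v, c < p i v → T (i, c) ≤ v := by
    intro i c v h
    calc T (i, c) ≤ (Finset.range v).card := Finset.card_le_card fun j hj => by
          simp only [Finset.mem_filter, Finset.mem_range] at hj ⊢
          by_contra hv
          exact absurd (hpm i (not_lt.1 hv)) (by omega)
      _ = v := Finset.card_range v
  have hTge : ∀ i c v, c < l i → p i v ≤ c → v + 1 ≤ T (i, c) := by
    intro i c v hc h
    have hv : v < i + 1 := by
      by_contra hv
      have := hpm i (not_lt.1 hv)
      rw [hpl] at this
      omega
    calc v + 1 = (Finset.range (v + 1)).card := (Finset.card_range _).symm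
      _ ≤ T (i, c) := Finset.card_le_card fun j hj => by
          simp only [Finset.mem_filter, Finset.mem_range] at hj ⊢
          exact ⟨by omega, (hpm i (Nat.lt_succ_iff.1 hj)).trans h⟩
  have hTeq : ∀ i c v, ((i, c) ∈ skewCells l m ∧ T (i, c) = v + 1) ↔
      p i v ≤ c ∧ c < p i (v + 1) := by
    intro i c v
    constructor
    · rintro ⟨⟨-, h2⟩, h3⟩
      constructor
      · by_contra h
        have := hTle i c v (not_le.1 h)
        omega
      · by_contra h
        have := hTge i c (v + 1) h2 (not_lt.1 h)
        omega
    · rintro ⟨h1, h2⟩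
      have h3 : c < l i := h2.trans_le (hpl' i _)
      have h4 := hTle i c _ h2
      have h5 := hTge i c v h3 h1
      exact ⟨⟨((hp0 i).symm.le.trans (hpm i (Nat.zero_le v))).trans h1, h3⟩, le_antisymm h4 h5⟩
  have hcount : ∀ I v, Set.ncard {d : ℕ × ℕ | d.1 < I ∧ p d.1 v ≤ d.2 ∧ d.2 < p d.1 (v + 1)} =
      ∑ i ∈ Finset.range I, a i v := by
    intro I v
    rw [ncard_rows I (fun i => p i v) fun i => p i (v + 1)]
    exact Finset.sum_congr rfl fun i _ => by rw [hpa]; omega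
  obtain ⟨N, hN⟩ := hl.2
  obtain ⟨N', hN'⟩ := ha.weight
  have hrow : ∀ i c v, p i v ≤ c → c < p i (v + 1) → i < N := by
    intro i c v _ h
    by_contra hi
    have := hpl' i (v + 1)
    rw [hN i (not_lt.1 hi)] at this
    omega
  refine lrCoeff_pos_of_filling (T := T) hl hν (fun i => (ha.row i) ▸ Nat.le_add_right _ _) ?_
  refine ⟨?_, fun j hj => ?_, fun i j j' h h' hjj => ?_, fun i i' j h h' hii => ?_,
    fun c hc j hj => ?_⟩
  · rintro ⟨i, c⟩ ⟨h1, h2⟩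
    exact hTge i c 0 h2 ((hp0 i).le.trans h1)
  · obtain ⟨v, rfl⟩ : ∃ v, j = v + 1 := ⟨j - 1, by omega⟩
    rw [Nat.add_sub_cancel, hN' (max N N') (le_max_right _ _), ← hcount]
    congr 1
    ext ⟨i, c⟩
    refine (hTeq i c v).trans ⟨fun h => ⟨?_, h⟩, fun h => h.2⟩
    exact (hrow i c v h.1 h.2).trans_le (le_max_left _ _)
  · exact Finset.card_le_card fun v hv => by
      simp only [Finset.mem_filter, Finset.mem_range] at hv ⊢
      omega
  · obtain ⟨v, hv⟩ : ∃ v, T (i', j) = v + 1 :=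
      ⟨T (i', j) - 1, by have := hTge i' j 0 h'.2 ((hp0 i').le.trans h'.1); omega⟩
    have h1 := ((hTeq i' j v).1 ⟨h', hv⟩).2
    have := hTle i j v (h1.trans_le (hps i i' v hii))
    omega
  · obtain ⟨v, rfl⟩ : ∃ v, j = v + 1 := ⟨j - 1, by omega⟩
    have hsub1 : {d | d ∈ skewCells l m ∧ T d = v + 1 + 1 ∧ readBefore d c} ⊆
        {d : ℕ × ℕ | d.1 < c.1 + 1 ∧ p d.1 (v + 1) ≤ d.2 ∧ d.2 < p d.1 (v + 1 + 1)} := by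
      rintro ⟨i, x⟩ ⟨h1, h2, h3⟩
      exact ⟨by rcases h3 with h3 | h3 <;> simp only at h3 ⊢ <;> omega, (hTeq _ _ _).1 ⟨h1, h2⟩⟩
    have hsub2 : {d : ℕ × ℕ | d.1 < c.1 ∧ p d.1 v ≤ d.2 ∧ d.2 < p d.1 (v + 1)} ⊆
        {d | d ∈ skewCells l m ∧ T d = v + 1 ∧ readBefore d c} := by
      rintro ⟨i, x⟩ ⟨h1, h2⟩
      obtain ⟨h3, h4⟩ := (hTeq i x v).2 h2
      exact ⟨h3, h4, Or.inl h1⟩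
    have hfin : {d | d ∈ skewCells l m ∧ T d = v + 1 ∧ readBefore d c}.Finite :=
      (finite_rows N (p · v) (p · (v + 1))).subset fun ⟨i, x⟩ ⟨h1, h2, _⟩ =>
        have h := (hTeq i x v).1 ⟨h1, h2⟩
        ⟨hrow i x v h.1 h.2, h⟩
    calc _ ≤ _ := Set.ncard_le_ncard hsub1 (finite_rows _ (p · (v + 1)) (p · (v + 1 + 1)))
      _ ≤ _ := by rw [hcount]; exact ha.lattice c.1 v
      _ ≤ _ := (hcount c.1 v).symm.le
      _ ≤ _ := Set.ncard_le_ncard hsub2 hfin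

/-! ### Splitting columns -/

/-- The partition whose columns are `b 0, …, b (w - 1)`, in any order. -/
def colPart (b : ℕ → ℕ) (w : ℕ) : ℕ → ℕ := fun i =>
  ∑ j ∈ Finset.range w, if i < b j then 1 else 0

theorem colPart_succ (b : ℕ → ℕ) (w : ℕ) : colPart b (w + 1) = addCol (b w) (colPart b w) := by
  funext i
  simp only [colPart, addCol, Finset.sum_range_succ]

theorem colPart_mem_Pset (b : ℕ → ℕ) (w : ℕ) :
    colPart b w ∈ Pset (∑ j ∈ Finset.range w, b j) := by
  induction w with
  | zero =>
    have h0 : colPart b 0 = fun _ => 0 := by funext i; simp [colPart]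
    rw [h0]
    exact ⟨⟨fun _ _ _ => le_rfl, 0, fun _ _ => rfl⟩, by
      rw [psize_eq_sum (N := 0) fun _ _ => rfl]; simp⟩
  | succ w ih =>
    rw [colPart_succ, Finset.sum_range_succ]
    exact ⟨isPartition_addCol ih.1, by rw [psize_addCol _ ih.1, ih.2, add_comm]⟩

theorem colPart_zero_apply (b : ℕ → ℕ) (w : ℕ) :
    colPart b w 0 = ((Finset.range w).filter fun j => 0 < b j).card := by
  simp [colPart]

theorem colPart_apply_eq_zero {b : ℕ → ℕ} {w t : ℕ} (h : ∀ j, b j ≤ t) : colPart b w t = 0 :=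
  Finset.sum_eq_zero fun j _ => if_neg (not_lt.2 (h j))

theorem colPart_conj {f : ℕ → ℕ} (hf : IsPartition f) : colPart (conj f) (f 0) = f := by
  funext i
  simp only [colPart, hf.lt_conj_iff, Finset.sum_boole, Nat.cast_id]
  have : (Finset.range (f 0)).filter (· < f i) = Finset.range (f i) := by
    ext j
    have := hf.1 (Nat.zero_le i)
    simp only [Finset.mem_filter, Finset.mem_range]
    omega
  rw [this, Finset.card_range]

theorem LRPos.colPart {c b : ℕ → ℕ} (h : ∀ j, b j ≤ c j) (w : ℕ) :
    LRPos (colPart c w) (colPart b w) (colPart (fun j => c j - b j) w) := by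
  induction w with
  | zero => exact LRPos.zero
  | succ w ih =>
    simp only [colPart_succ]
    have := ih.addCol (b w) (c w - b w)
    rwa [Nat.add_sub_cancel' (h w)] at this

theorem LRPos.of_le_conj {f b : ℕ → ℕ} (hf : IsPartition f) (h : ∀ j, b j ≤ conj f j) :
    LRPos f (SylowBranching.colPart b (f 0))
      (SylowBranching.colPart (fun j => SylowBranching.conj f j - b j) (f 0)) := by
  have := LRPos.colPart h (f 0)
  rwa [colPart_conj hf] at this

theorem sum_conj {f : ℕ → ℕ} {n : ℕ} (hf : f ∈ Pset n) :
    ∑ j ∈ Finset.range (f 0), conj f j = n := by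
  rw [← (colPart_mem_Pset (conj f) (f 0)).2, colPart_conj hf.1, hf.2]

theorem exists_sum_eq {l u : ℕ → ℕ} (hlu : ∀ j, l j ≤ u j) (w t : ℕ)
    (hl : ∑ j ∈ Finset.range w, l j ≤ t) (hu : t ≤ ∑ j ∈ Finset.range w, u j) :
    ∃ b : ℕ → ℕ, (∀ j, l j ≤ b j ∧ b j ≤ u j) ∧ ∑ j ∈ Finset.range w, b j = t := by
  induction w generalizing t with
  | zero =>
    simp only [Finset.range_zero, Finset.sum_empty] at hl hu ⊢
    exact ⟨l, fun j => ⟨le_rfl, hlu j⟩, by omega⟩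
  | succ w ih =>
    rw [Finset.sum_range_succ] at hl hu
    have hw := hlu w
    have hs : ∑ j ∈ Finset.range w, l j ≤ ∑ j ∈ Finset.range w, u j :=
      Finset.sum_le_sum fun j _ => hlu j
    obtain ⟨b, hb, hbt⟩ := ih (t - min (u w) (t - ∑ j ∈ Finset.range w, l j)) (by omega) (by omega)
    refine ⟨Function.update b w (min (u w) (t - ∑ j ∈ Finset.range w, l j)), fun j => ?_, ?_⟩
    · by_cases hj : j = w
      · subst hj; simp; omega
      · simpa [hj] using hb j
    · rw [Finset.sum_range_succ, Finset.sum_congr rfl fun j hj =>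
        Function.update_of_ne (Finset.mem_range.1 hj).ne _ _, hbt,
        Function.update_self]
      omega

theorem sum_tsub {c b : ℕ → ℕ} (h : ∀ j, b j ≤ c j) {w s t : ℕ}
    (hc : ∑ j ∈ Finset.range w, c j = s + t) (hb : ∑ j ∈ Finset.range w, b j = s) :
    ∑ j ∈ Finset.range w, (c j - b j) = t := by
  have : ∑ j ∈ Finset.range w, (b j + (c j - b j)) = s + t := by
    rw [← hc]
    exact Finset.sum_congr rfl fun j _ => Nat.add_sub_cancel' (h j)
  rw [Finset.sum_add_distrib, hb] at this
  omega

theorem exists_split {f : ℕ → ℕ} {s t : ℕ} (hf : f ∈ Pset (s + t)) :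
    ∃ g ∈ Pset s, ∃ h ∈ Pset t, LRPos f g h := by
  have hc := sum_conj hf
  obtain ⟨b, hb, hbs⟩ := exists_sum_eq (l := fun _ => 0) (u := conj f) (fun _ => Nat.zero_le _)
    (f 0) s (by simp) (by omega)
  refine ⟨_, hbs ▸ colPart_mem_Pset b (f 0), _, ?_, LRPos.of_le_conj hf.1 fun j => (hb j).2⟩
  rw [← sum_tsub (fun j => (hb j).2) hc hbs]
  exact colPart_mem_Pset _ _

theorem sum_range_le_of_eq_zero {f : ℕ → ℕ} {w : ℕ} (hf : ∀ j, w ≤ j → f j = 0) (K : ℕ) :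
    ∑ j ∈ Finset.range K, f j ≤ ∑ j ∈ Finset.range w, f j := by
  rw [Finset.sum_subset (Finset.range_subset_range.2 (le_max_left w K))
    fun j _ hj => hf j (by simpa using hj)]
  exact Finset.sum_le_sum_of_subset (Finset.range_subset_range.2 (le_max_right w K))

theorem two_mul_le_sum_range {c : ℕ → ℕ} (hc : Antitone c) {w k : ℕ} (hkw : k ≤ w)
    (hw : 2 * w ≤ ∑ j ∈ Finset.range w, c j) : 2 * k ≤ ∑ j ∈ Finset.range k, c j := by
  by_cases h : 2 ≤ c k
  · calc 2 * k = ∑ _j ∈ Finset.range k, 2 := by simp [mul_comm]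
      _ ≤ _ := Finset.sum_le_sum fun j hj => h.trans (hc (Finset.mem_range.1 hj).le)
  · have h1 : ∑ j ∈ Finset.Ico k w, c j ≤ ∑ _j ∈ Finset.Ico k w, 1 :=
      Finset.sum_le_sum fun j hj => (hc (Finset.mem_Ico.1 hj).1).trans (by omega)
    have h2 := Finset.sum_range_add_sum_Ico c hkw
    simp only [Finset.sum_const, Nat.card_Ico, smul_eq_mul, mul_one] at h1
    omega

theorem exists_column_split {c : ℕ → ℕ} {w m₁ m₂ : ℕ} (hc : Antitone c)
    (hcw : ∀ j, w ≤ j → c j = 0) (hsum : ∑ j ∈ Finset.range w, c j = m₁ + m₂)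
    (h27 : 27 ≤ m₁) (h12 : m₁ ≤ m₂) (hw : 2 * w ≤ m₁ + m₂) (hc0 : 2 * c 0 ≤ m₁ + m₂) :
    ∃ b : ℕ → ℕ, (∀ j, b j ≤ c j) ∧ ∑ j ∈ Finset.range w, b j = m₁ ∧
      (∀ j, b j ≤ m₁ - 4) ∧ (∀ j, c j - b j ≤ m₂ - 4) ∧
      ((Finset.range w).filter fun j => 0 < b j).card ≤ m₁ - 4 ∧
      ((Finset.range w).filter fun j => 0 < c j - b j).card ≤ m₂ - 4 := by
  have hmul : ∀ j, (j + 1) * c j ≤ m₁ + m₂ := fun j => by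
    calc (j + 1) * c j = ∑ _i ∈ Finset.range (j + 1), c j := by simp
      _ ≤ ∑ i ∈ Finset.range (j + 1), c i :=
        Finset.sum_le_sum fun i hi => hc (Nat.lt_succ_iff.1 (Finset.mem_range.1 hi))
      _ ≤ m₁ + m₂ := hsum ▸ sum_range_le_of_eq_zero hcw _
  have hc1 : c 1 ≤ c 0 := hc (Nat.zero_le 1)
  have hc2 : ∀ j, 2 ≤ j → c j ≤ m₂ - 4 := fun j hj => by
    have h1 := hmul 2
    have h2 := hc hj
    omega
  have htail : ∀ j, m₂ - 4 ≤ j → c j ≤ 2 := fun j hj => by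
    refine (hc hj).trans ?_
    by_contra h
    have h1 := hmul (m₂ - 4)
    have h2 : (m₂ - 4 + 1) * 3 ≤ (m₂ - 4 + 1) * c (m₂ - 4) := Nat.mul_le_mul_left _ (by omega)
    omega
  obtain ⟨k, hk⟩ : ∃ k, k = (m₁ + 1) / 2 := ⟨_, rfl⟩
  -- the last columns go entirely to the first factor, which otherwise only meets the first `k`
  let l : ℕ → ℕ := fun j => if j < m₂ - 4 then c j - (m₂ - 4) else c j
  let u : ℕ → ℕ := fun j =>
    if j < k then min (c j) (m₁ - 4) else if j < m₂ - 4 then 0 else c j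
  have hlu : ∀ j, l j ≤ u j := fun j => by
    have h2 := hc2 j
    have h0 := hc (Nat.zero_le j)
    simp only [l, u]
    split_ifs <;> omega
  have huc : ∀ j, u j ≤ c j := fun j => by
    simp only [u]
    split_ifs <;> omega
  have hl : ∑ j ∈ Finset.range w, l j ≤ m₁ := by
    have hle : ∀ j ∈ Finset.range w, l j ≤ (if j ∈ Finset.range 2 then 4 else 0) +
        if j ∈ Finset.Ico (m₂ - 4) m₂ then 2 else 0 := fun j hj => by
      have h2 := hc2 j
      have h0 := hc (Nat.zero_le j)
      have ht := htail j
      simp only [l, Finset.mem_range, Finset.mem_Ico] at hj ⊢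
      split_ifs <;> omega
    refine (Finset.sum_le_sum hle).trans ?_
    rw [Finset.sum_add_distrib, Finset.sum_ite_mem, Finset.sum_ite_mem]
    have h1 := Finset.card_le_card
      (Finset.inter_subset_right (s₁ := Finset.range w) (s₂ := Finset.range 2))
    have h2 := Finset.card_le_card
      (Finset.inter_subset_right (s₁ := Finset.range w) (s₂ := Finset.Ico (m₂ - 4) m₂))
    simp only [Finset.card_range, Nat.card_Ico] at h1 h2
    simp only [Finset.sum_const, smul_eq_mul]
    omega
  have hu : m₁ ≤ ∑ j ∈ Finset.range w, u j := by
    have hsub := sum_range_le_of_eq_zero (f := u) (w := w)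
      fun j hj => Nat.le_zero.1 ((huc j).trans (hcw j hj).le)
    have huk : ∀ j, j < k → u j = min (c j) (m₁ - 4) := fun j hj => if_pos hj
    by_cases h0 : c 0 ≤ m₁ - 4
    · have huk' : ∀ j, j < k → u j = c j := fun j hj => by
        have := hc (Nat.zero_le j)
        rw [huk j hj]
        omega
      by_cases hkw : k ≤ w
      · have h1 := two_mul_le_sum_range hc hkw (by omega)
        have h2 := hsub k
        have h3 : ∑ j ∈ Finset.range k, u j = ∑ j ∈ Finset.range k, c j :=
          Finset.sum_congr rfl fun j hj => huk' j (Finset.mem_range.1 hj)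
        omega
      · have h3 : ∑ j ∈ Finset.range w, u j = ∑ j ∈ Finset.range w, c j :=
          Finset.sum_congr rfl fun j hj => huk' j (by have := Finset.mem_range.1 hj; omega)
        omega
    · by_cases h4 : c 4 = 0
      · have h5 : ∑ j ∈ Finset.range w, c j ≤ ∑ j ∈ Finset.range 4, c j :=
          sum_range_le_of_eq_zero (fun j hj => Nat.le_zero.1 ((hc hj).trans h4.le)) w
        have h6 := hsub 2
        have h7 : c 2 ≤ c 1 := hc (by omega)
        have h8 : c 3 ≤ c 1 := hc (by omega)
        simp only [Finset.sum_range_succ, Finset.sum_range_zero] at h5 h6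
        rw [huk 0 (by omega), huk 1 (by omega)] at h6
        omega
      · have h6 := hsub 5
        have h1 : c 4 ≤ c 1 := hc (by omega)
        have h2 : c 4 ≤ c 2 := hc (by omega)
        have h3 : c 4 ≤ c 3 := hc (by omega)
        simp only [Finset.sum_range_succ, Finset.sum_range_zero] at h6
        rw [huk 0 (by omega), huk 1 (by omega), huk 2 (by omega), huk 3 (by omega),
          huk 4 (by omega)] at h6
        omega
  obtain ⟨b, hb, hbs⟩ := exists_sum_eq hlu w m₁ hl hu
  refine ⟨b, fun j => (hb j).2.trans (huc j), hbs, fun j => ?_, fun j => ?_, ?_, ?_⟩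
  · have h1 := (hb j).2
    have ht := htail j
    simp only [u] at h1
    split_ifs at h1 <;> omega
  · have h1 := (hb j).1
    simp only [l] at h1
    split_ifs at h1 <;> omega
  · calc _ ≤ (Finset.range k ∪ Finset.Ico (m₂ - 4) m₂).card :=
          Finset.card_le_card fun j hj => by
            have h1 := (hb j).2
            simp only [Finset.mem_filter, Finset.mem_range, Finset.mem_union,
              Finset.mem_Ico] at hj ⊢
            simp only [u] at h1
            split_ifs at h1 <;> omega
      _ ≤ _ := Finset.card_union_le _ _
      _ ≤ m₁ - 4 := by
        simp only [Finset.card_range, Nat.card_Ico]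
        omega
  · calc _ ≤ (Finset.range (m₂ - 4)).card := Finset.card_le_card fun j hj => by
          have h1 := (hb j).1
          simp only [Finset.mem_filter, Finset.mem_range] at hj ⊢
          simp only [l] at h1
          split_ifs at h1 <;> omega
      _ = _ := Finset.card_range _

theorem mem_Bset_iff {f : ℕ → ℕ} {n t : ℕ} :
    f ∈ Bset n t ↔ f ∈ Pset n ∧ f 0 ≤ t ∧ f t = 0 := by
  refine and_congr_right fun hf => and_congr_right fun _ => ?_
  rw [hf.1.conj_le_iff, Nat.le_zero]

theorem apply_zero_le_psize {f : ℕ → ℕ} (hf : IsPartition f) : f 0 ≤ psize f := by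
  rw [← hf.conj_le_iff, Nat.le_zero]
  exact apply_eq_zero_of_psize_le hf.conj (psize_conj f hf).le

theorem consPart_mem_Bset {f : ℕ → ℕ} {n t a b : ℕ} (hf : f ∈ Pset b) (hba : b ≤ a)
    (hn : a + b = n) (hat : a ≤ t) (hbt : b < t) : consPart a f ∈ Bset n t := by
  have h0 : f 0 ≤ a := (apply_zero_le_psize hf.1).trans (hf.2.le.trans hba)
  refine mem_Bset_iff.2 ⟨⟨isPartition_consPart hf.1 h0, ?_⟩, by simpa [consPart] using hat, ?_⟩
  · rw [psize_consPart a hf.1, hf.2, hn]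
  · have := apply_eq_zero_of_psize_le hf.1 (t := t - 1) (by rw [hf.2]; omega)
    simp only [consPart, this]
    split_ifs <;> omega

theorem addCol_mem_Bset {f : ℕ → ℕ} {n t a b : ℕ} (hf : f ∈ Pset b)
    (hn : a + b = n) (hat : a ≤ t) (hbt : b < t) : addCol a f ∈ Bset n t := by
  have h0 : f 0 ≤ b := (apply_zero_le_psize hf.1).trans hf.2.le
  refine mem_Bset_iff.2 ⟨⟨isPartition_addCol hf.1, ?_⟩, ?_, ?_⟩
  · rw [psize_addCol a hf.1, hf.2, hn]
  · simp only [addCol]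
    split_ifs <;> omega
  · have := apply_eq_zero_of_psize_le hf.1 (t := t) (by rw [hf.2]; omega)
    simp only [addCol, this]
    split_ifs <;> omega

/-! ### Every partition of the right-hand side occurs -/

/-- The set `A_i`, for the Sylow subgroup of the symmetric group of degree `m`. -/
def type31 (m : ℕ) : Set (ℕ → ℕ) :=
  Bset m (m - 4) ∪ conjClosure {ofList [m - 3, 3], ofList [m - 3, 1, 1, 1]}

theorem ofList_cons (a : ℕ) (L : List ℕ) : ofList (a :: L) = consPart a (ofList L) := by
  funext i
  rcases i with _ | i <;> simp [ofList, consPart]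

theorem ofList_apply_of_le {L : List ℕ} {i : ℕ} (h : L.length ≤ i) : ofList L i = 0 :=
  List.getD_eq_default _ _ h

theorem psize_ofList (L : List ℕ) : psize (ofList L) = L.sum := by
  rw [psize_eq_sum (N := L.length) fun i => ofList_apply_of_le]
  induction L with
  | nil => simp
  | cons a L ih =>
    rw [List.length_cons, Finset.sum_range_succ', List.sum_cons, ← ih, add_comm]
    simp [ofList]

theorem isPartition_ofList {L : List ℕ} (h : L.Pairwise (· ≥ ·)) : IsPartition (ofList L) := by
  refine ⟨?_, L.length, fun i => ofList_apply_of_le⟩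
  induction L with
  | nil => intro i j _; simp [ofList]
  | cons a L ih =>
    rw [List.pairwise_cons] at h
    rw [ofList_cons]
    refine (isPartition_consPart ⟨ih h.2, L.length, fun i => ofList_apply_of_le⟩ ?_).1
    rcases L with _ | ⟨b, L⟩
    · simp [ofList]
    · simpa [ofList] using h.1 b (by simp)

theorem ofList_mem_Pset {L : List ℕ} {n : ℕ} (h : L.Pairwise (· ≥ ·)) (hn : L.sum = n) :
    ofList L ∈ Pset n :=
  ⟨isPartition_ofList h, (psize_ofList L).trans hn⟩

theorem conj_ofList_three : conj (ofList [3]) = ofList [1, 1, 1] := by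
  apply conj_eq_of_lt_iff
  rintro (_ | i) (_ | _ | _ | j) <;> simp [ofList]

theorem conj_ofList_ones : conj (ofList [1, 1, 1]) = ofList [3] := by
  rw [← conj_ofList_three, (isPartition_ofList (by simp)).conj_conj]

theorem conj_ofList_staircase : conj (ofList [3, 2, 1]) = ofList [3, 2, 1] := by
  apply conj_eq_of_lt_iff
  rintro (_ | _ | _ | i) (_ | _ | _ | j) <;> simp [ofList]

/-- The one-row and the one-column partition of `3`. -/
def stripThree : Set (ℕ → ℕ) := {ofList [3], ofList [1, 1, 1]}

theorem stripThree_subset_Pset : stripThree ⊆ Pset 3 := by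
  rintro f (rfl | rfl)
  · exact ofList_mem_Pset (by simp) (by simp)
  · exact ofList_mem_Pset (by simp) (by simp)

theorem apply_zero_le_of_mem_stripThree {f : ℕ → ℕ} (hf : f ∈ stripThree) : f 0 ≤ 3 := by
  rcases hf with rfl | rfl <;> simp [ofList]

theorem consPart_mem_type31 {m : ℕ} {f : ℕ → ℕ} (hf : f ∈ stripThree) :
    consPart (m - 3) f ∈ type31 m := by
  refine Or.inr (Or.inl ?_)
  rcases hf with rfl | rfl
  · exact Or.inl (ofList_cons _ _).symm
  · exact Or.inr (ofList_cons _ _).symm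

theorem addCol_mem_type31 {m : ℕ} (hm : 6 ≤ m) {f : ℕ → ℕ} (hf : f ∈ stripThree) :
    addCol (m - 3) f ∈ type31 m := by
  refine Or.inr (Or.inr ?_)
  rcases hf with rfl | rfl
  · refine ⟨_, Or.inr rfl, ?_⟩
    rw [ofList_cons, conj_consPart (isPartition_ofList (by simp)) (by simp [ofList]; omega),
      conj_ofList_ones]
  · refine ⟨_, Or.inl rfl, ?_⟩
    rw [ofList_cons, conj_consPart (isPartition_ofList (by simp)) (by simp [ofList]; omega),
      conj_ofList_three]

theorem type31_cases {m : ℕ} (hm : 6 ≤ m) {f : ℕ → ℕ} (hf : f ∈ type31 m) :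
    f ∈ Bset m (m - 4) ∨ (∃ g ∈ stripThree, f = consPart (m - 3) g) ∨
      ∃ g ∈ stripThree, f = addCol (m - 3) g := by
  rcases hf with hf | (rfl | rfl) | ⟨_, rfl | rfl, rfl⟩
  · exact Or.inl hf
  · exact Or.inr (Or.inl ⟨_, Or.inl rfl, ofList_cons _ _⟩)
  · exact Or.inr (Or.inl ⟨_, Or.inr rfl, ofList_cons _ _⟩)
  · refine Or.inr (Or.inr ⟨_, Or.inr rfl, ?_⟩)
    rw [ofList_cons, conj_consPart (isPartition_ofList (by simp)) (by simp [ofList]; omega),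
      conj_ofList_three]
  · refine Or.inr (Or.inr ⟨_, Or.inl rfl, ?_⟩)
    rw [ofList_cons, conj_consPart (isPartition_ofList (by simp)) (by simp [ofList]; omega),
      conj_ofList_ones]

theorem type31_subset_Pset {m : ℕ} (hm : 6 ≤ m) : type31 m ⊆ Pset m := by
  intro f hf
  rcases type31_cases hm hf with hf | ⟨g, hg, rfl⟩ | ⟨g, hg, rfl⟩
  · exact hf.1
  · have h := stripThree_subset_Pset hg
    refine ⟨isPartition_consPart h.1 ((apply_zero_le_of_mem_stripThree hg).trans (by omega)), ?_⟩
    rw [psize_consPart _ h.1, h.2]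
    omega
  · have h := stripThree_subset_Pset hg
    refine ⟨isPartition_addCol h.1, ?_⟩
    rw [psize_addCol _ h.1, h.2]
    omega

theorem exists_lrPos_Bset {m₁ m₂ : ℕ} (h₁ : 27 ≤ m₁) (h₂ : 27 ≤ m₂)
    (hpar : 2 ∣ m₁ + m₂) {f : ℕ → ℕ} (hf : f ∈ Bset (m₁ + m₂) (m₁ + m₂ - 8)) :
    ∃ g ∈ Bset m₁ (m₁ - 4), ∃ h ∈ Bset m₂ (m₂ - 4), LRPos f g h := by
  obtain ⟨hfP, hf0, hf1⟩ := hf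
  have hxy : ∀ t, m₁ + m₂ < 2 * t → t ≤ m₁ + m₂ - 8 → ∃ x y, x + y = t ∧
      m₁ ≤ 2 * x ∧ x ≤ m₁ - 4 ∧ m₂ ≤ 2 * y ∧ y ≤ m₂ - 4 := by
    intro t ht ht'
    by_cases h : t ≤ m₁ - 4 + (m₂ + 1) / 2
    · exact ⟨t - (m₂ + 1) / 2, (m₂ + 1) / 2, by omega⟩
    · exact ⟨m₁ - 4, t - (m₁ - 4), by omega⟩
  by_cases hrow : m₁ + m₂ < 2 * f 0
  · obtain ⟨x, y, hs, hx, hx', hy, hy'⟩ := hxy _ hrow hf0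
    obtain ⟨κ, hκ, hκ0, rfl⟩ := exists_consPart_of_mem_Pset (b := (m₁ - x) + (m₂ - y)) hfP hs.symm
      (by omega)
    obtain ⟨α, hα, β, hβ, hR⟩ := exists_split hκ
    refine ⟨_, consPart_mem_Bset hα (by omega) (by omega) hx' (by omega), _,
      consPart_mem_Bset hβ (by omega) (by omega) hy' (by omega), hR.consPart ?_ ?_⟩
    · exact (apply_zero_le_psize hα.1).trans (by rw [hα.2]; omega)
    · exact (apply_zero_le_psize hβ.1).trans (by rw [hβ.2]; omega)
  by_cases hcol : m₁ + m₂ < 2 * conj f 0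
  · obtain ⟨x, y, hs, hx, hx', hy, hy'⟩ := hxy _ hcol hf1
    obtain ⟨κ, hκ, -, -, he⟩ := exists_addCol_of_mem_Pset (b := (m₁ - x) + (m₂ - y)) hfP hs.symm
      (by omega)
    obtain ⟨α, hα, β, hβ, hR⟩ := exists_split (conj_mem_Pset hκ)
    rw [he]
    exact ⟨_, addCol_mem_Bset hα (by omega) hx' (by omega), _,
      addCol_mem_Bset hβ (by omega) hy' (by omega), hR.addCol x y⟩
  have hsum := sum_conj hfP
  have hvan : ∀ j, f 0 ≤ j → conj f j = 0 := fun j hj =>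
    Nat.le_zero.1 ((hfP.1.conj_le_iff _ _).2 hj)
  have hmem : ∀ {b : ℕ → ℕ} {m : ℕ}, ∑ j ∈ Finset.range (f 0), b j = m → (∀ j, b j ≤ m - 4) →
      ((Finset.range (f 0)).filter fun j => 0 < b j).card ≤ m - 4 →
      colPart b (f 0) ∈ Bset m (m - 4) := fun hs hb hn =>
    mem_Bset_iff.2 ⟨hs ▸ colPart_mem_Pset _ _, (colPart_zero_apply _ _).trans_le hn,
      colPart_apply_eq_zero hb⟩
  rcases le_total m₁ m₂ with h | h
  · obtain ⟨b, hbc, hbs, hb1, hb2, hn1, hn2⟩ :=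
      exists_column_split hfP.1.conj.1 hvan hsum h₁ h (by omega) (by omega)
    exact ⟨_, hmem hbs hb1 hn1, _, hmem (sum_tsub hbc hsum hbs) hb2 hn2,
      LRPos.of_le_conj hfP.1 hbc⟩
  · obtain ⟨b, hbc, hbs, hb1, hb2, hn1, hn2⟩ :=
      exists_column_split hfP.1.conj.1 hvan (hsum.trans (add_comm _ _)) h₂ h (by omega) (by omega)
    have hR := LRPos.of_le_conj hfP.1 (b := fun j => conj f j - b j) fun j => Nat.sub_le _ _
    have hbb : (fun j => conj f j - (conj f j - b j)) = b := by
      funext j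
      have := hbc j
      omega
    rw [hbb] at hR
    exact ⟨_, hmem (sum_tsub hbc (hsum.trans (add_comm _ _)) hbs) hb2 hn2, _, hmem hbs hb1 hn1, hR⟩

theorem exists_lrPos_stripThree {f : ℕ → ℕ} {t : ℕ} (hf : f ∈ Pset (3 + t)) (ht : 4 ≤ t) :
    ∃ g ∈ stripThree, ∃ h ∈ Pset t, LRPos f g h := by
  have hsum := sum_conj hf
  by_cases h3 : 3 ≤ f 0
  · have hb : ∀ j, (if j < 3 then 1 else 0) ≤ conj f j := fun j => by
      have := hf.1.lt_conj_iff 0 j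
      split_ifs <;> omega
    have hbs : ∑ j ∈ Finset.range (f 0), (if j < 3 then 1 else 0) = 3 := by
      rw [Finset.sum_boole]
      have : (Finset.range (f 0)).filter (· < 3) = Finset.range 3 := by ext j; simp; omega
      simp [this]
    refine ⟨_, Or.inl ?_, _, ?_, LRPos.of_le_conj hf.1 hb⟩
    · funext i
      rcases i with _ | i
      · refine (Finset.sum_congr rfl fun j _ => ?_).trans hbs
        dsimp only
        split_ifs <;> omega
      · refine (Finset.sum_eq_zero fun j _ => if_neg ?_).trans (by simp [ofList])
        dsimp only
        split_ifs <;> omega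
    · rw [← sum_tsub hb hsum hbs]
      exact colPart_mem_Pset _ _
  · have hw : 1 ≤ f 0 := by
      by_contra h0
      rw [show f 0 = 0 by omega] at hsum
      simp at hsum
      omega
    have h0 : 3 ≤ conj f 0 := by
      have h1 : conj f 1 ≤ conj f 0 := hf.1.conj.1 (by omega)
      rcases (by omega : f 0 = 1 ∨ f 0 = 2) with h | h <;> rw [h] at hsum <;>
        simp [Finset.sum_range_succ] at hsum <;> omega
    have hb : ∀ j, (if j = 0 then 3 else 0) ≤ conj f j := fun j => by
      split_ifs with h
      · rwa [h]
      · omega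
    have hbs : ∑ j ∈ Finset.range (f 0), (if j = 0 then 3 else 0) = 3 := by
      simp; omega
    refine ⟨_, Or.inr ?_, _, ?_, LRPos.of_le_conj hf.1 hb⟩
    · funext i
      obtain ⟨w, hw⟩ : ∃ w, f 0 = w + 1 := ⟨f 0 - 1, by omega⟩
      rw [hw, colPart, Finset.sum_range_succ']
      rcases i with _ | _ | _ | i <;> simp [ofList]
    · rw [← sum_tsub hb hsum hbs]
      exact colPart_mem_Pset _ _

theorem eq_ofList_of_mem_Pset_six {f : ℕ → ℕ} (hf : f ∈ Pset 6) :
    f ∈ ({ofList [6], ofList [5, 1], ofList [4, 2], ofList [3, 3], ofList [4, 1, 1],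
      ofList [3, 2, 1], ofList [3, 1, 1, 1], ofList [2, 2, 2], ofList [2, 2, 1, 1],
      ofList [2, 1, 1, 1, 1], ofList [1, 1, 1, 1, 1, 1]} : Set (ℕ → ℕ)) := by
  have hv : ∀ i, 6 ≤ i → f i = 0 := fun i hi => apply_eq_zero_of_psize_le hf.1 (hf.2.le.trans hi)
  have hs := hf.2
  rw [psize_eq_sum hv] at hs
  simp only [Finset.sum_range_succ, Finset.sum_range_zero] at hs
  have h0 : f 1 ≤ f 0 := hf.1.1 (by omega)
  have h1 : f 2 ≤ f 1 := hf.1.1 (by omega)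
  have h2 : f 3 ≤ f 2 := hf.1.1 (by omega)
  have h3 : f 4 ≤ f 3 := hf.1.1 (by omega)
  have h4 : f 5 ≤ f 4 := hf.1.1 (by omega)
  have key : ∀ L : List ℕ, L.length ≤ 6 → (f = ofList L ↔ f 5 = ofList L 5 ∧ f 4 = ofList L 4 ∧
      f 3 = ofList L 3 ∧ f 2 = ofList L 2 ∧ f 1 = ofList L 1 ∧ f 0 = ofList L 0) := by
    refine fun L hL => ⟨by rintro rfl; simp, ?_⟩
    rintro ⟨e5, e4, e3, e2, e1, e0⟩
    funext i
    rcases i with _ | _ | _ | _ | _ | _ | i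
    iterate 6 assumption
    rw [hv _ (by omega), ofList_apply_of_le (by omega)]
  have c5 : f 5 = 0 ∨ f 5 = 1 := by omega
  have c4 : f 4 = 0 ∨ f 4 = 1 := by omega
  have c3 : f 3 = 0 ∨ f 3 = 1 := by omega
  have c2 : f 2 = 0 ∨ f 2 = 1 ∨ f 2 = 2 := by omega
  have c1 : f 1 = 0 ∨ f 1 = 1 ∨ f 1 = 2 ∨ f 1 = 3 := by omega
  simp only [Set.mem_insert_iff, Set.mem_singleton_iff]
  repeat rw [key _ (by simp)]
  simp [ofList]
  clear key hv hf
  rcases c5 with c5 | c5 <;> rcases c4 with c4 | c4 <;> rcases c3 with c3 | c3 <;>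
    rcases c2 with c2 | c2 | c2 <;> rcases c1 with c1 | c1 | c1 | c1 <;>
    first | (exfalso; omega) | (simp [c1, c2, c3, c4, c5]; omega)

theorem exists_lrPos_six {f : ℕ → ℕ} (hf : f ∈ Pset 6) (hne : f ≠ ofList [3, 2, 1]) :
    ∃ g ∈ stripThree, ∃ h ∈ stripThree, LRPos f g h := by
  have z := LRPos.zero
  have hz : (ofList [3] ∈ stripThree) ∧ ofList [1, 1, 1] ∈ stripThree := ⟨Or.inl rfl, Or.inr rfl⟩
  rcases eq_ofList_of_mem_Pset_six hf with
    rfl | rfl | rfl | rfl | rfl | rfl | rfl | rfl | rfl | rfl | rfl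
  · refine ⟨_, hz.1, _, hz.1, ?_⟩
    convert (((((z.addCol 1 0).addCol 1 0).addCol 1 0).addCol 0 1).addCol 0 1).addCol 0 1
      using 1 <;>
    · funext i; rcases i with _ | i <;> simp [ofList, addCol]
  · refine ⟨_, hz.1, _, hz.1, ?_⟩
    convert ((((z.addCol 1 1).addCol 1 0).addCol 1 0).addCol 0 1).addCol 0 1 using 1 <;>
    · funext i; rcases i with _ | _ | i <;> simp [ofList, addCol]
  · refine ⟨_, hz.1, _, hz.1, ?_⟩
    convert (((z.addCol 1 1).addCol 1 1).addCol 1 0).addCol 0 1 using 1 <;>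
    · funext i; rcases i with _ | _ | i <;> simp [ofList, addCol]
  · refine ⟨_, hz.1, _, hz.1, ?_⟩
    convert ((z.addCol 1 1).addCol 1 1).addCol 1 1 using 1 <;>
    · funext i; rcases i with _ | _ | i <;> simp [ofList, addCol]
  · refine ⟨_, hz.1, _, hz.2, ?_⟩
    convert (((z.addCol 0 3).addCol 1 0).addCol 1 0).addCol 1 0 using 1 <;>
    · funext i; rcases i with _ | _ | _ | i <;> simp [ofList, addCol]
  · exact absurd rfl hne
  · refine ⟨_, hz.1, _, hz.2, ?_⟩
    convert ((z.addCol 1 3).addCol 1 0).addCol 1 0 using 1 <;>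
    · funext i; rcases i with _ | _ | _ | _ | i <;> simp [ofList, addCol]
  · refine ⟨_, hz.2, _, hz.2, ?_⟩
    convert (z.addCol 3 0).addCol 0 3 using 1 <;>
    · funext i; rcases i with _ | _ | _ | i <;> simp [ofList, addCol] <;>
      split_ifs <;> omega
  · refine ⟨_, hz.2, _, hz.2, ?_⟩
    convert ((z.addCol 1 1).consPart (x := 1) (y := 1) (by simp [addCol])
      (by simp [addCol])).consPart (x := 1) (y := 1) (by simp [consPart])
      (by simp [consPart]) using 1 <;>
    · funext i; rcases i with _ | _ | _ | _ | i <;> simp [ofList, addCol, consPart]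
  · refine ⟨_, hz.2, _, hz.2, ?_⟩
    convert (z.addCol 2 2).consPart (x := 1) (y := 1) (by simp [addCol])
      (by simp [addCol]) using 1 <;>
    · funext i; rcases i with _ | _ | _ | _ | _ | i <;> simp [ofList, addCol, consPart]
  · refine ⟨_, hz.2, _, hz.2, ?_⟩
    convert z.addCol 3 3 using 1 <;>
    · funext i; rcases i with _ | _ | _ | _ | _ | _ | i <;> simp [ofList, addCol]

/-- The right-hand side of the identity, for factors of degrees adding up to `n`. -/
def type31Product (n : ℕ) : Set (ℕ → ℕ) :=
  Bset n (n - 7) ∪ conjClosure (consPart (n - 6) '' (Pset 6 \ {ofList [3, 2, 1]}))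

theorem exists_lrPos_type31 {m₁ m₂ : ℕ} (h₁ : 27 ≤ m₁) (h₂ : 27 ≤ m₂) (hpar : 2 ∣ m₁ + m₂)
    {f : ℕ → ℕ} (hf : f ∈ type31Product (m₁ + m₂)) :
    IsPartition f ∧ ∃ g ∈ type31 m₁, ∃ h ∈ type31 m₂, LRPos f g h := by
  have e6 : m₁ + m₂ - 6 = (m₁ - 3) + (m₂ - 3) := by omega
  rcases hf with hf | ⟨κ, ⟨hκ, hne⟩, rfl⟩ | ⟨_, ⟨κ, ⟨hκ, hne⟩, rfl⟩, rfl⟩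
  · refine ⟨hf.1.1, ?_⟩
    by_cases hrow : f 0 = m₁ - 3 + (m₂ - 4)
    · obtain ⟨κ, hκ, -, rfl⟩ := exists_consPart_of_mem_Pset (b := 3 + 4) hf.1 hrow (by omega)
      obtain ⟨α, hα, β, hβ, hR⟩ := exists_lrPos_stripThree hκ le_rfl
      have hα0 := apply_zero_le_of_mem_stripThree hα
      have hβ0 := apply_zero_le_psize hβ.1
      rw [hβ.2] at hβ0
      exact ⟨_, consPart_mem_type31 hα, _, Or.inl (consPart_mem_Bset hβ (by omega) (by omega)
        le_rfl (by omega)), hR.consPart (by omega) (by omega)⟩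
    by_cases hcol : conj f 0 = m₁ - 3 + (m₂ - 4)
    · obtain ⟨κ, hκ, -, -, he⟩ := exists_addCol_of_mem_Pset (b := 3 + 4) hf.1 hcol (by omega)
      obtain ⟨α, hα, β, hβ, hR⟩ := exists_lrPos_stripThree (conj_mem_Pset hκ) le_rfl
      rw [he]
      exact ⟨_, addCol_mem_type31 (by omega) hα, _, Or.inl (addCol_mem_Bset hβ (by omega)
        le_rfl (by omega)), hR.addCol _ _⟩
    obtain ⟨hP, h0, h1⟩ := hf
    obtain ⟨g, hg, h, hh, hR⟩ := exists_lrPos_Bset h₁ h₂ hpar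
      (f := f) ⟨hP, by omega, by omega⟩
    exact ⟨g, Or.inl hg, h, Or.inl hh, hR⟩
  · have hκ0 := apply_zero_le_psize hκ.1
    rw [hκ.2] at hκ0
    obtain ⟨α, hα, β, hβ, hR⟩ := exists_lrPos_six hκ hne
    have hα0 := apply_zero_le_of_mem_stripThree hα
    have hβ0 := apply_zero_le_of_mem_stripThree hβ
    refine ⟨isPartition_consPart hκ.1 (by omega), _, consPart_mem_type31 hα, _,
      consPart_mem_type31 hβ, ?_⟩
    rw [e6]
    exact hR.consPart (by omega) (by omega)
  · have hκ0 := apply_zero_le_psize hκ.1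
    rw [hκ.2] at hκ0
    obtain ⟨α, hα, β, hβ, hR⟩ := exists_lrPos_six (conj_mem_Pset hκ) fun h => hne (by
      rw [Set.mem_singleton_iff, ← hκ.1.conj_conj, h, conj_ofList_staircase])
    rw [conj_consPart hκ.1 (by omega)]
    refine ⟨isPartition_addCol hκ.1.conj, _, addCol_mem_type31 (by omega) hα, _,
      addCol_mem_type31 (by omega) hβ, ?_⟩
    rw [e6]
    exact hR.addCol _ _

theorem IsLRFilling.exists_readBefore {γ : Set (ℕ × ℕ)} {ν : ℕ → ℕ} {T : ℕ × ℕ → ℕ}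
    (hT : IsLRFilling γ ν T) (hγ : γ.Finite) {c : ℕ × ℕ} (hc : c ∈ γ) (h2 : 2 ≤ T c) :
    ∃ d ∈ γ, T d + 1 = T c ∧ readBefore d c := by
  have h := hT.lattice c hc (T c - 1) (by omega)
  have h1 : 0 < Set.ncard {d ∈ γ | T d = T c - 1 + 1 ∧ readBefore d c} :=
    (Set.ncard_pos (hγ.subset fun _ h => h.1)).2 ⟨c, hc, by omega, Or.inr ⟨rfl, le_rfl⟩⟩
  obtain ⟨d, hd, hd1, hd2⟩ := (Set.ncard_pos (hγ.subset fun _ h => h.1)).1 (h1.trans_le h)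
  exact ⟨d, hd, by omega, hd2⟩

theorem psize_add_ncard_skewCells {l m : ℕ → ℕ} (hl : IsPartition l) (hml : ∀ i, m i ≤ l i) :
    psize m + (skewCells l m).ncard = psize l := by
  obtain ⟨N, hN⟩ := hl.2
  have hN' : ∀ i, N ≤ i → m i = 0 := fun i hi => by
    have := hml i
    have := hN i hi
    omega
  have hs : skewCells l m = {d | d.1 < N ∧ m d.1 ≤ d.2 ∧ d.2 < l d.1} := by
    ext d
    refine ⟨fun h => ⟨?_, h⟩, fun h => h.2⟩
    by_contra hd
    have := hN d.1 (by omega)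
    have := h.2
    omega
  rw [hs, ncard_rows, psize_eq_sum hN', psize_eq_sum hN, ← Finset.sum_add_distrib]
  exact Finset.sum_congr rfl fun i _ => Nat.add_sub_cancel' (hml i)

theorem IsLRFilling.ncard_eq_psize {γ : Set (ℕ × ℕ)} {ν : ℕ → ℕ} {T : ℕ × ℕ → ℕ}
    (hT : IsLRFilling γ ν T) (hγ : γ.Finite) (hν : IsPartition ν) : γ.ncard = psize ν := by
  obtain ⟨M, hM⟩ := hν.2
  rw [psize_eq_sum hM, Set.ncard_eq_toFinset_card γ hγ,
    Finset.card_eq_sum_card_fiberwise (f := fun c => T c - 1) (t := Finset.range M)]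
  · refine Finset.sum_congr rfl fun j _ => ?_
    have hj := hT.weight (j + 1) (by omega)
    rw [Nat.add_sub_cancel] at hj
    rw [← hj, ← Set.ncard_coe_finset]
    congr 1
    ext c
    simp only [Finset.coe_filter, Set.Finite.mem_toFinset, Set.mem_ofPred_eq]
    refine and_congr_right fun hc => ?_
    have := hT.pos c hc
    omega
  · intro c hc
    have hc' : c ∈ γ := by simpa using hc
    have := hT.weight_pos hγ hc'
    rw [Finset.mem_coe, Finset.mem_range]
    by_contra h
    exact this.ne' (hM _ (not_lt.1 h))

theorem IsLRFilling.apply_zero_eq_one {l m ν : ℕ → ℕ} {T : ℕ × ℕ → ℕ} (hl : IsPartition l)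
    (hT : IsLRFilling (skewCells l m) ν T) {x : ℕ} (hx : (0, x) ∈ skewCells l m) :
    T (0, x) = 1 := by
  have hx1 : m 0 ≤ x := hx.1
  have hx2 : x < l 0 := hx.2
  have hc : (0, l 0 - 1) ∈ skewCells l m :=
    ⟨show m 0 ≤ l 0 - 1 by omega, show l 0 - 1 < l 0 by omega⟩
  have h1 := hT.pos _ hx
  have h2 := hT.row_weak 0 x (l 0 - 1) hx hc (by omega)
  by_contra hne
  obtain ⟨⟨i, y⟩, hd, hd1, hd2⟩ :=
    hT.exists_readBefore (skewCells_finite hl m) hc (by omega)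
  rcases hd2 with hd2 | ⟨hi, hy⟩
  · simp at hd2
  · simp only at hi hy
    subst hi
    have hy2 : y < l 0 := hd.2
    obtain rfl : y = l 0 - 1 := by omega
    omega

theorem ncard_skewCells_row_zero (l m : ℕ → ℕ) :
    {d ∈ skewCells l m | d.1 = 0}.ncard = l 0 - m 0 := by
  have := ncard_rows 1 m l
  rw [Finset.sum_range_one] at this
  rw [← this]
  congr 1
  ext d
  simp only [skewCells, Set.mem_ofPred_eq]
  omega

theorem IsLRFilling.row_zero_subset {l m ν : ℕ → ℕ} {T : ℕ × ℕ → ℕ} (hl : IsPartition l)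
    (hT : IsLRFilling (skewCells l m) ν T) :
    {d ∈ skewCells l m | d.1 = 0} ⊆ {d ∈ skewCells l m | T d = 1} := by
  rintro ⟨i, x⟩ ⟨hd, hi⟩
  simp only at hi
  subst hi
  exact ⟨hd, hT.apply_zero_eq_one hl hd⟩

theorem IsLRFilling.apply_zero_le_add {l m ν : ℕ → ℕ} {T : ℕ × ℕ → ℕ} (hl : IsPartition l)
    (hT : IsLRFilling (skewCells l m) ν T) : l 0 ≤ m 0 + ν 0 := by
  have h := Set.ncard_le_ncard (hT.row_zero_subset hl)
    ((skewCells_finite hl m).subset fun _ h => h.1)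
  rw [ncard_skewCells_row_zero, hT.weight 1 le_rfl, Nat.sub_self] at h
  omega

theorem IsLRFilling.fst_eq_zero_of_eq_one {l m ν : ℕ → ℕ} {T : ℕ × ℕ → ℕ} (hl : IsPartition l)
    (hT : IsLRFilling (skewCells l m) ν T) (h0 : m 0 + ν 0 ≤ l 0) {d : ℕ × ℕ}
    (hd : d ∈ skewCells l m) (h1 : T d = 1) : d.1 = 0 := by
  have h := Set.eq_of_subset_of_ncard_le (hT.row_zero_subset hl) (by
    rw [ncard_skewCells_row_zero, hT.weight 1 le_rfl, Nat.sub_self]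
    omega) ((skewCells_finite hl m).subset fun _ h => h.1)
  have hd' : d ∈ {d ∈ skewCells l m | T d = 1} := ⟨hd, h1⟩
  rw [← h] at hd'
  exact hd'.2

theorem IsLRFilling.apply_add_le {l m ν : ℕ → ℕ} {T : ℕ × ℕ → ℕ} (hl : Antitone l)
    (hm : Antitone m) (hT : IsLRFilling (skewCells l m) ν T) {r x : ℕ}
    (hr : (r, x) ∈ skewCells l m) (k : ℕ) (hk : (r + k, x) ∈ skewCells l m) :
    T (r, x) + k ≤ T (r + k, x) := by
  induction k with
  | zero => simp
  | succ k ih =>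
    have hk' : (r + k, x) ∈ skewCells l m :=
      ⟨(hm (Nat.le_add_right r k)).trans hr.1,
        lt_of_lt_of_le hk.2 (hl (show r + k ≤ r + (k + 1) by omega))⟩
    have := ih hk'
    have := hT.col_strict _ _ _ hk' hk (by omega)
    omega

theorem IsLRFilling.conj_zero_le_add {l m ν : ℕ → ℕ} {T : ℕ × ℕ → ℕ} (hl : IsPartition l)
    (hm : IsPartition m) (hν : IsPartition ν) (hT : IsLRFilling (skewCells l m) ν T) :
    conj l 0 ≤ conj m 0 + conj ν 0 := by
  by_contra! h
  have hmem : ∀ i, conj m 0 ≤ i → i < conj l 0 → (i, 0) ∈ skewCells l m := fun i h1 h2 =>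
    ⟨(hm.conj_le_iff i 0).1 h1, (hl.lt_conj_iff i 0).1 h2⟩
  have hlast := hmem (conj m 0 + conj ν 0) (by omega) h
  have hfirst := hmem (conj m 0) le_rfl (by omega)
  have h1 := hT.apply_add_le hl.1 hm.1 hfirst _ hlast
  have h2 := hT.pos _ hfirst
  have h3 := (hν.lt_conj_iff _ 0).2 (hT.weight_pos (skewCells_finite hl m) hlast)
  omega

theorem type31_row_cases {m : ℕ} (hm : 8 ≤ m) {f : ℕ → ℕ} (hf : f ∈ type31 m) :
    f 0 ≤ m - 4 ∨ ∃ g ∈ stripThree, f = consPart (m - 3) g := by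
  rcases type31_cases (by omega) hf with hf | hf | ⟨g, hg, rfl⟩
  · exact Or.inl hf.2.1
  · exact Or.inr hf
  · have := apply_zero_le_of_mem_stripThree hg
    left
    simp only [addCol]
    split_ifs <;> omega

theorem type31_col_cases {m : ℕ} (hm : 8 ≤ m) {f : ℕ → ℕ} (hf : f ∈ type31 m) :
    conj f 0 ≤ m - 4 ∨ (∃ g ∈ stripThree, f = addCol (m - 3) g) ∧ conj f 0 = m - 3 := by
  have hP := (type31_subset_Pset (by omega) hf).1
  rcases type31_cases (by omega) hf with hf | ⟨g, hg, rfl⟩ | ⟨g, hg, rfl⟩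
  · exact Or.inl hf.2.2
  · left
    have hg' := stripThree_subset_Pset hg
    have := apply_eq_zero_of_psize_le hg'.1 (t := m - 4 - 1) (by rw [hg'.2]; omega)
    rw [hP.conj_le_iff, consPart, if_neg (by omega), this]
  · right
    have hg' := stripThree_subset_Pset hg
    have := apply_eq_zero_of_psize_le hg'.1 (t := m - 3) (by rw [hg'.2]; omega)
    refine ⟨⟨g, hg, rfl⟩, le_antisymm ?_ ?_⟩
    · rw [hP.conj_le_iff, addCol, this]
      simp
    · have := (hP.lt_conj_iff (m - 3 - 1) 0).2 (by
        rw [addCol, if_pos (by omega)]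
        omega)
      omega

/-- If the cells below the first row of `l / m` form the shape `(2, 1)` and the first rows add
up, the weight cannot be `(b, 3)` or `(b, 1, 1, 1)`. -/
theorem IsLRFilling.not_hook_below_row_zero {l m β : ℕ → ℕ} {T : ℕ × ℕ → ℕ} {b r c : ℕ}
    (hl : IsPartition l) (hβ : β ∈ stripThree)
    (hT : IsLRFilling (skewCells l m) (consPart b β) T) (h0 : m 0 + b ≤ l 0) (hr : r ≠ 0)
    (hA : (r, c) ∈ skewCells l m) (hB : (r, c + 1) ∈ skewCells l m)
    (hC : (r + 1, c) ∈ skewCells l m)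
    (hcov : ∀ i j, (i, j) ∈ skewCells l m → i = 0 ∨ i = r ∧ j = c ∨ i = r ∧ j = c + 1 ∨
      i = r + 1 ∧ j = c) : False := by
  have hfin := skewCells_finite hl m
  have hge : ∀ i j, (i, j) ∈ skewCells l m → i ≠ 0 → 2 ≤ T (i, j) := by
    intro i j hd hi
    have h1 := hT.pos _ hd
    by_contra h
    exact hi (hT.fst_eq_zero_of_eq_one hl h0 hd (by omega))
  have hA2 := hge _ _ hA hr
  have hAB := hT.row_weak _ _ _ hA hB (by omega)
  have hAC := hT.col_strict _ _ _ hA hC (by omega)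
  have hB2 : T (r, c + 1) = 2 := by
    by_contra hne
    obtain ⟨⟨i, j⟩, hd, hd1, hd2⟩ := hT.exists_readBefore hfin hB (by omega)
    simp only [readBefore] at hd2
    rcases hcov i j hd with rfl | ⟨rfl, rfl⟩ | ⟨rfl, rfl⟩ | ⟨rfl, rfl⟩
    · have := hT.apply_zero_eq_one hl hd
      omega
    all_goals omega
  rcases hβ with rfl | rfl
  · have h := hT.weight_pos hfin hC
    obtain ⟨t, ht⟩ : ∃ t, T (r + 1, c) - 1 = t + 2 := ⟨T (r + 1, c) - 3, by omega⟩
    rw [ht] at h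
    simp [consPart, ofList] at h
  · have h := hT.weight 2 (by omega)
    have hsub : ({(r, c), (r, c + 1)} : Set (ℕ × ℕ)) ⊆ {d ∈ skewCells l m | T d = 2} := by
      rintro d (rfl | rfl)
      · exact ⟨hA, by omega⟩
      · exact ⟨hB, hB2⟩
    have h' := Set.ncard_le_ncard hsub (hfin.subset fun _ h => h.1)
    rw [Set.ncard_pair (by simp), h] at h'
    simp [consPart, ofList] at h'

/-- If `l / m` consists of a shape `(2, 1)` above a column of length `b`, the weight cannot be
obtained from `(3)` or `(1, 1, 1)` by adding a column of length `b`. -/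
theorem IsLRFilling.not_hook_above_column {l m β : ℕ → ℕ} {T : ℕ × ℕ → ℕ} {a b r c : ℕ}
    (hl : IsPartition l) (hm : Antitone m) (hb : 3 ≤ b) (hβ : β ∈ stripThree)
    (hT : IsLRFilling (skewCells l m) (addCol b β) T) (hra : r + 1 < a)
    (hA : (r, c) ∈ skewCells l m) (hB : (r, c + 1) ∈ skewCells l m)
    (hC : (r + 1, c) ∈ skewCells l m)
    (hcol : ∀ i, a ≤ i → i < a + b → (i, 0) ∈ skewCells l m)
    (hcov : ∀ i j, (i, j) ∈ skewCells l m → i = r ∧ j = c ∨ i = r ∧ j = c + 1 ∨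
      i = r + 1 ∧ j = c ∨ a ≤ i ∧ i < a + b ∧ j = 0) : False := by
  have hfin := skewCells_finite hl m
  have hA1 := hT.pos _ hA
  have hAB := hT.row_weak _ _ _ hA hB (by omega)
  have hAC := hT.col_strict _ _ _ hA hC (by omega)
  have hB1 : T (r, c + 1) = 1 := by
    by_contra hne
    obtain ⟨⟨i, j⟩, hd, hd1, hd2⟩ := hT.exists_readBefore hfin hB (by omega)
    simp only [readBefore] at hd2
    rcases hcov i j hd with ⟨rfl, rfl⟩ | ⟨rfl, rfl⟩ | ⟨rfl, rfl⟩ | ⟨h1, h2, rfl⟩ <;> omega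
  have hfirst := hcol a le_rfl (by omega)
  have hlast := hcol (a + (b - 1)) (by omega) (by omega)
  have hD : T (a, 0) = 1 := by
    have h1 := hT.pos _ hfirst
    have h2 := hT.apply_add_le hl.1 hm hfirst _ hlast
    have h3 := hT.weight_pos hfin hlast
    by_contra hne
    have hge : b ≤ T (a + (b - 1), 0) - 1 := by omega
    have hz : β (T (a + (b - 1), 0) - 1) = 0 :=
      apply_eq_zero_of_psize_le (stripThree_subset_Pset hβ).1
        ((stripThree_subset_Pset hβ).2.le.trans (by omega))
    rw [addCol, if_neg (by omega), hz] at h3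
    omega
  have hset : {d ∈ skewCells l m | T d = 1} = {(r, c), (r, c + 1), (a, 0)} := by
    ext ⟨i, j⟩
    simp only [Set.mem_ofPred_eq, Set.mem_insert_iff, Set.mem_singleton_iff, Prod.mk.injEq]
    constructor
    · rintro ⟨hd, hd1⟩
      rcases hcov i j hd with ⟨rfl, rfl⟩ | ⟨rfl, rfl⟩ | ⟨rfl, rfl⟩ | ⟨h1, h2, rfl⟩
      · omega
      · omega
      · omega
      · obtain ⟨k, rfl⟩ := Nat.exists_eq_add_of_le h1
        have := hT.apply_add_le hl.1 hm hfirst k hd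
        omega
    · rintro (⟨rfl, rfl⟩ | ⟨rfl, rfl⟩ | ⟨rfl, rfl⟩)
      · exact ⟨hA, by omega⟩
      · exact ⟨hB, hB1⟩
      · exact ⟨hfirst, hD⟩
  have h := hT.weight 1 le_rfl
  rw [hset, Set.ncard_insert_of_notMem (by simp; omega), Set.ncard_pair (by simp)] at h
  rcases hβ with rfl | rfl
  all_goals
    rw [addCol, if_pos (by omega)] at h
    simp [ofList] at h

theorem not_isLRFilling_consPart_staircase {a b : ℕ} (ha : 3 ≤ a) {α β : ℕ → ℕ}
    (hα : α ∈ stripThree) (hβ : β ∈ stripThree) (T : ℕ × ℕ → ℕ) :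
    ¬ IsLRFilling (skewCells (consPart (a + b) (ofList [3, 2, 1])) (consPart a α))
      (consPart b β) T := by
  intro hT
  have hl : IsPartition (consPart (a + b) (ofList [3, 2, 1])) :=
    isPartition_consPart (isPartition_ofList (by simp)) (by simp [ofList]; omega)
  rcases hα with rfl | rfl
  · refine hT.not_hook_below_row_zero (r := 2) (c := 0) hl hβ (by simp [consPart]) (by simp)
      (by simp [skewCells, consPart, ofList]) (by simp [skewCells, consPart, ofList])
      (by simp [skewCells, consPart, ofList]) ?_
    rintro (_ | _ | _ | _ | i) j <;> simp [skewCells, consPart, ofList]; omega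
  · refine hT.not_hook_below_row_zero (r := 1) (c := 1) hl hβ (by simp [consPart]) (by simp)
      (by simp [skewCells, consPart, ofList]) (by simp [skewCells, consPart, ofList])
      (by simp [skewCells, consPart, ofList]) ?_
    rintro (_ | _ | _ | _ | i) j <;> simp [skewCells, consPart, ofList] <;> omega

theorem not_isLRFilling_addCol_staircase {a b : ℕ} (ha : 4 ≤ a) (hb : 3 ≤ b) {α β : ℕ → ℕ}
    (hα : α ∈ stripThree) (hβ : β ∈ stripThree) (T : ℕ × ℕ → ℕ) :
    ¬ IsLRFilling (skewCells (addCol (a + b) (ofList [3, 2, 1])) (addCol a α))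
      (addCol b β) T := by
  intro hT
  have hl : IsPartition (addCol (a + b) (ofList [3, 2, 1])) :=
    isPartition_addCol (isPartition_ofList (by simp))
  have hm := (isPartition_addCol (x := a) (stripThree_subset_Pset hα).1).1
  have hcol : ∀ i, a ≤ i → i < a + b →
      (i, 0) ∈ skewCells (addCol (a + b) (ofList [3, 2, 1])) (addCol a α) := by
    intro i h1 h2
    have := apply_eq_zero_of_psize_le (stripThree_subset_Pset hα).1 (t := i)
      ((stripThree_subset_Pset hα).2.le.trans (by omega))
    simp only [skewCells, addCol, Set.mem_ofPred_eq, this]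
    split_ifs <;> omega
  rcases hα with rfl | rfl
  · refine hT.not_hook_above_column (a := a) (r := 1) (c := 1) hl hm hb hβ (by omega)
      ?_ ?_ ?_ hcol ?_
    iterate 3 simp [skewCells, addCol, ofList]; split_ifs <;> omega
    rintro (_ | _ | _ | i) j <;> simp [skewCells, addCol, ofList] <;> split_ifs <;> omega
  · refine hT.not_hook_above_column (a := a) (r := 0) (c := 2) hl hm hb hβ (by omega)
      ?_ ?_ ?_ hcol ?_
    iterate 3 simp [skewCells, addCol, ofList]; split_ifs <;> omega
    rintro (_ | _ | _ | i) j <;> simp [skewCells, addCol, ofList] <;> split_ifs <;> omega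

theorem mem_type31Product_of_lrCoeff_pos {m₁ m₂ : ℕ} (h₁ : 27 ≤ m₁) (h₂ : 27 ≤ m₂)
    {l g h : ℕ → ℕ} (hl : IsPartition l) (hg : g ∈ type31 m₁) (hh : h ∈ type31 m₂)
    (hpos : 0 < LRcoeff l g h) : l ∈ type31Product (m₁ + m₂) := by
  obtain ⟨T, hml, -, hT⟩ := Set.nonempty_of_ncard_ne_zero hpos.ne'
  have hgP := type31_subset_Pset (by omega) hg
  have hhP := type31_subset_Pset (by omega) hh
  have hlP : l ∈ Pset (m₁ + m₂) := ⟨hl, by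
    rw [← psize_add_ncard_skewCells hl hml, hT.ncard_eq_psize (skewCells_finite hl g) hhP.1,
      hgP.2, hhP.2]⟩
  have hrow := hT.apply_zero_le_add hl
  have hcol := hT.conj_zero_le_add hl hgP.1 hhP.1
  have e6 : m₁ + m₂ - 6 = (m₁ - 3) + (m₂ - 3) := by omega
  have hc0 : ∀ a f, consPart a f 0 = a := fun a f => rfl
  by_cases hr : m₁ + m₂ - 6 ≤ l 0
  · rcases type31_row_cases (by omega) hg with hg' | ⟨α, hα, rfl⟩
    · rcases type31_row_cases (by omega) hh with hh' | ⟨β, -, rfl⟩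
      · omega
      · rw [hc0] at hrow
        omega
    rcases type31_row_cases (by omega) hh with hh' | ⟨β, hβ, rfl⟩
    · rw [hc0] at hrow
      omega
    rw [hc0, hc0] at hrow
    obtain ⟨κ, hκ, -, rfl⟩ := exists_consPart_of_mem_Pset (a := m₁ + m₂ - 6) (b := 6) hlP
      (by omega) (by omega)
    refine Or.inr (Or.inl ⟨κ, ⟨hκ, ?_⟩, rfl⟩)
    rintro rfl
    rw [e6] at hT
    exact not_isLRFilling_consPart_staircase (by omega) hα hβ T hT
  by_cases hc : m₁ + m₂ - 6 ≤ conj l 0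
  · rcases type31_col_cases (by omega) hg with hg' | ⟨⟨α, hα, rfl⟩, hg'⟩
    · rcases type31_col_cases (by omega) hh with hh' | ⟨-, hh'⟩ <;> omega
    rcases type31_col_cases (by omega) hh with hh' | ⟨⟨β, hβ, rfl⟩, hh'⟩
    · omega
    obtain ⟨κ, hκ, -, he, he'⟩ := exists_addCol_of_mem_Pset (a := m₁ + m₂ - 6) (b := 6) hlP
      (by omega) (by omega)
    refine Or.inr (Or.inr ⟨_, ⟨κ, ⟨hκ, ?_⟩, rfl⟩, by rw [← he, hl.conj_conj]⟩)
    rintro rfl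
    rw [he', e6, conj_ofList_staircase] at hT
    exact not_isLRFilling_addCol_staircase (by omega) (by omega) hα hβ T hT
  exact Or.inl ⟨hlP, by omega, by omega⟩

theorem starOp_type31 {m₁ m₂ : ℕ} (h₁ : 27 ≤ m₁) (h₂ : 27 ≤ m₂) (hpar : 2 ∣ m₁ + m₂) :
    starOp (type31 m₁) (type31 m₂) = type31Product (m₁ + m₂) := by
  ext l
  constructor
  · rintro ⟨hl, g, hg, h, hh, hpos⟩
    exact mem_type31Product_of_lrCoeff_pos h₁ h₂ hl hg hh hpos
  · intro hl
    obtain ⟨hl', g, hg, h, hh, hR⟩ := exists_lrPos_type31 h₁ h₂ hpar hl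
    exact ⟨hl', g, hg, h, hh, hR.lrCoeff_pos hl' (type31_subset_Pset (by omega) hh).1⟩

/-- for `k₁, k₂ ≥ 3` and `n = 3^{k₁} + 3^{k₂}`, with
`A_i = B_{3^{k_i}}(3^{k_i}−4) ∪ {(3^{k_i}−3, 3), (3^{k_i}−3, 1, 1, 1)}°`, one has
`A_1 ⋆ A_2 = B_n(n−7) ∪ {(n−6, μ) : μ ∈ P(6), μ ≠ (3,2,1)}°`. -/
theorem star_type31_type31 (k₁ k₂ : ℕ) (h₁ : 3 ≤ k₁) (h₂ : 3 ≤ k₂) :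
    starOp
        (Bset (3 ^ k₁) (3 ^ k₁ - 4) ∪
          conjClosure {ofList [3 ^ k₁ - 3, 3], ofList [3 ^ k₁ - 3, 1, 1, 1]})
        (Bset (3 ^ k₂) (3 ^ k₂ - 4) ∪
          conjClosure {ofList [3 ^ k₂ - 3, 3], ofList [3 ^ k₂ - 3, 1, 1, 1]}) =
      Bset (3 ^ k₁ + 3 ^ k₂) (3 ^ k₁ + 3 ^ k₂ - 7) ∪
        conjClosure
          (consPart (3 ^ k₁ + 3 ^ k₂ - 6) '' (Pset 6 \ {ofList [3, 2, 1]})) := by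
  have h27 : ∀ k, 3 ≤ k → 27 ≤ 3 ^ k := fun k hk =>
    (Nat.pow_le_pow_right (n := 3) (by omega) hk)
  have hodd : ∀ k, Odd (3 ^ k) := fun k => Odd.pow (by decide)
  exact starOp_type31 (h27 k₁ h₁) (h27 k₂ h₂) ((hodd k₁).add_odd (hodd k₂)).two_dvd

end SylowBranching
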